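/- Let 0<α<1 and 0<β<∞, let u be holomorphic on 𝔻 and φ a holomorphic self-map of 𝔻, and suppose uC_φ maps B^α boundedly into Z_β. Then there exist constants c, C > 0 depending only on α and β (not on u and φ) such that c·M ≤ ‖uC_φ‖_e ≤ C·M, where ‖uC_φ‖_e is the essential norm of uC_φ : B^α → Z_β and M = max{ limsup_{|φ(z)|→1} (1-|z|²)^β |2u'(z)φ'(z) + u(z)φ''(z)| / (1-|φ(z)|²)^α, limsup_{|φ(z)|→1} (1-|z|²)^β |u(z)| |φ'(z)|² / (1-|φ(z)|²)^{α+1} }. -/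

import Mathlib

open Complex Filter Set

noncomputable section

/-- The open unit disk in `ℂ`. -/
def unitDisk : Set ℂ := Metric.ball 0 1

/-- The weighted sup-norm `‖g‖_{ν_γ} = sup_{z ∈ 𝔻} (1-|z|²)^γ |g(z)|`. -/
def wnorm (γ : ℝ) (g : ℂ → ℂ) : ℝ :=
  sSup ((fun z => (1 - ‖z‖ ^ 2) ^ γ * ‖g z‖) '' unitDisk)

/-- Membership in the weighted Banach space `H^∞_{ν_β}`. -/
def MemWeighted (β : ℝ) (g : ℂ → ℂ) : Prop :=
  DifferentiableOn ℂ g unitDisk ∧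
    BddAbove ((fun z => (1 - ‖z‖ ^ 2) ^ β * ‖g z‖) '' unitDisk)

/-- Membership in the Bloch type space `B^α`. -/
def MemBloch (α : ℝ) (f : ℂ → ℂ) : Prop :=
  DifferentiableOn ℂ f unitDisk ∧
    BddAbove ((fun z => (1 - ‖z‖ ^ 2) ^ α * ‖deriv f z‖) '' unitDisk)

/-- The Bloch type norm `‖f‖_{B^α} = |f(0)| + sup_{z∈𝔻}(1-|z|²)^α |f'(z)|`. -/
def blochNorm (α : ℝ) (f : ℂ → ℂ) : ℝ :=
  ‖f 0‖ + wnorm α (deriv f)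

/-- Membership in the Zygmund type space `Z_β`. -/
def MemZygmund (β : ℝ) (f : ℂ → ℂ) : Prop :=
  DifferentiableOn ℂ f unitDisk ∧
    BddAbove ((fun z => (1 - ‖z‖ ^ 2) ^ β * ‖deriv (deriv f) z‖) '' unitDisk)

/-- The Zygmund type norm `‖f‖_{Z_β} = |f(0)| + |f'(0)| + sup_{z∈𝔻}(1-|z|²)^β |f''(z)|`. -/
def zygNorm (β : ℝ) (f : ℂ → ℂ) : ℝ :=
  ‖f 0‖ + ‖deriv f 0‖ + wnorm β (deriv (deriv f))

/-- The weighted composition operator `uC_φ f = u · (f ∘ φ)`. -/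
def wcomp (u φ f : ℂ → ℂ) : ℂ → ℂ := fun z => u z * f (φ z)

/-- `uC_φ` maps `B^α` boundedly into `Z_β`. -/
def BoundedBlochToZygmund (α β : ℝ) (u φ : ℂ → ℂ) : Prop :=
  (∀ f, MemBloch α f → MemZygmund β (wcomp u φ f)) ∧
    ∃ C > 0, ∀ f, MemBloch α f → zygNorm β (wcomp u φ f) ≤ C * blochNorm α f

/-- `uC_φ` maps `B^α` boundedly into `H^∞_{ν_β}`. -/
def BoundedBlochToWeighted (α β : ℝ) (u φ : ℂ → ℂ) : Prop :=
  (∀ f, MemBloch α f → MemWeighted β (wcomp u φ f)) ∧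
    ∃ C > 0, ∀ f, MemBloch α f → wnorm β (wcomp u φ f) ≤ C * blochNorm α f

/-- `uC_φ : B^α → Z_β` is compact: it is bounded and maps bounded sets of `B^α` to
totally bounded (equivalently, since `Z_β` is complete, relatively compact) subsets
of `Z_β`. -/
def CompactBlochToZygmund (α β : ℝ) (u φ : ℂ → ℂ) : Prop :=
  BoundedBlochToZygmund α β u φ ∧
    ∀ r : ℝ, ∀ ε : ℝ, 0 < ε → ∃ T : Finset (ℂ → ℂ),
      (∀ g ∈ T, MemZygmund β g) ∧
      ∀ f, MemBloch α f → blochNorm α f ≤ r →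
        ∃ g ∈ T, zygNorm β (fun z => wcomp u φ f z - g z) ≤ ε

/-- `uC_φ : B^α → H^∞_{ν_β}` is compact: it is bounded and maps bounded sets of `B^α`
to totally bounded (equivalently, relatively compact) subsets of `H^∞_{ν_β}`. -/
def CompactBlochToWeighted (α β : ℝ) (u φ : ℂ → ℂ) : Prop :=
  BoundedBlochToWeighted α β u φ ∧
    ∀ r : ℝ, ∀ ε : ℝ, 0 < ε → ∃ T : Finset (ℂ → ℂ),
      (∀ g ∈ T, MemWeighted β g) ∧
      ∀ f, MemBloch α f → blochNorm α f ≤ r →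
        ∃ g ∈ T, wnorm β (fun z => wcomp u φ f z - g z) ≤ ε

/-- A compact (linear, bounded, with totally bounded image of the unit ball) operator
from the subspace of `B^α` cut out by the predicate `P` into `Z_β`. -/
def IsCompactOpToZygmund (α β : ℝ) (P : (ℂ → ℂ) → Prop) (K : (ℂ → ℂ) → ℂ → ℂ) : Prop :=
  (∀ f g, P f → P g → ∀ a b : ℂ,
      K (fun z => a * f z + b * g z) = fun z => a * K f z + b * K g z) ∧
  (∀ f, P f → MemZygmund β (K f)) ∧
  (∃ C, ∀ f, P f → zygNorm β (K f) ≤ C * blochNorm α f) ∧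
  (∀ ε : ℝ, 0 < ε → ∃ T : Finset (ℂ → ℂ), (∀ g ∈ T, MemZygmund β g) ∧
      ∀ f, P f → blochNorm α f ≤ 1 → ∃ g ∈ T, zygNorm β (fun z => K f z - g z) ≤ ε)

/-- The essential norm of `uC_φ`, as an operator from the subspace of `B^α` cut out by
the predicate `P` into `Z_β`: the distance to the compact operators, the operator norm
being the supremum over the unit ball. -/
def essNormZ (α β : ℝ) (P : (ℂ → ℂ) → Prop) (u φ : ℂ → ℂ) : ℝ :=
  sInf {r | ∃ K, IsCompactOpToZygmund α β P K ∧
    r = sSup {s | ∃ f, P f ∧ blochNorm α f ≤ 1 ∧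
          s = zygNorm β (fun z => wcomp u φ f z - K f z)}}

/-- A compact (linear, bounded, with totally bounded image of the unit ball) operator
from `B^α` into `H^∞_{ν_β}`. -/
def IsCompactOpToWeighted (α β : ℝ) (K : (ℂ → ℂ) → ℂ → ℂ) : Prop :=
  (∀ f g, MemBloch α f → MemBloch α g → ∀ a b : ℂ,
      K (fun z => a * f z + b * g z) = fun z => a * K f z + b * K g z) ∧
  (∀ f, MemBloch α f → MemWeighted β (K f)) ∧
  (∃ C, ∀ f, MemBloch α f → wnorm β (K f) ≤ C * blochNorm α f) ∧
  (∀ ε : ℝ, 0 < ε → ∃ T : Finset (ℂ → ℂ), (∀ g ∈ T, MemWeighted β g) ∧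
      ∀ f, MemBloch α f → blochNorm α f ≤ 1 → ∃ g ∈ T, wnorm β (fun z => K f z - g z) ≤ ε)

/-- The essential norm of `uC_φ : B^α → H^∞_{ν_β}`. -/
def essNormW (α β : ℝ) (u φ : ℂ → ℂ) : ℝ :=
  sInf {r | ∃ K, IsCompactOpToWeighted α β K ∧
    r = sSup {s | ∃ f, MemBloch α f ∧ blochNorm α f ≤ 1 ∧
          s = wnorm β (fun z => wcomp u φ f z - K f z)}}

/-- `limsup_{|φ(z)|→1} F(z) = lim_{s→1⁻} sup {F z : z ∈ 𝔻, |φ z| > s}`.  Since the inner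
supremum is nonincreasing in `s`, the limit equals the infimum over `s ∈ [0,1)`; note
that `Real.sSup ∅ = 0`, matching the convention that the value is `0` when
`{z : |φ z| > s}` is empty for some `s < 1`. -/
def phiLimsup (φ : ℂ → ℂ) (F : ℂ → ℝ) : ℝ :=
  sInf ((fun s => sSup {y | ∃ z ∈ unitDisk, s < ‖φ z‖ ∧ y = F z}) '' Set.Ico (0:ℝ) 1)

lemma isOpen_unitDisk : IsOpen unitDisk := Metric.isOpen_ball

lemma norm_lt_one_of_mem {z : ℂ} (hz : z ∈ unitDisk) : ‖z‖ < 1 := by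
  simpa [unitDisk] using hz

lemma mem_unitDisk_of_norm_lt {z : ℂ} (hz : ‖z‖ < 1) : z ∈ unitDisk := by
  simpa [unitDisk] using hz

lemma zero_mem_unitDisk : (0 : ℂ) ∈ unitDisk := mem_unitDisk_of_norm_lt (by simp)

lemma one_sub_norm_sq_pos {z : ℂ} (hz : z ∈ unitDisk) : 0 < 1 - ‖z‖ ^ 2 := by
  have := norm_lt_one_of_mem hz
  nlinarith [norm_nonneg z]

lemma one_sub_norm_sq_le (z : ℂ) : 1 - ‖z‖ ^ 2 ≤ 1 := by
  nlinarith [norm_nonneg z]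

lemma differentiableAt_of_mem {f : ℂ → ℂ} (hf : DifferentiableOn ℂ f unitDisk) {z : ℂ}
    (hz : z ∈ unitDisk) : DifferentiableAt ℂ f z :=
  hf.differentiableAt (isOpen_unitDisk.mem_nhds hz)

lemma differentiableOn_deriv {f : ℂ → ℂ} (hf : DifferentiableOn ℂ f unitDisk) :
    DifferentiableOn ℂ (deriv f) unitDisk :=
  hf.deriv isOpen_unitDisk

lemma deriv_eq_of_eqOn {f g : ℂ → ℂ} (h : EqOn f g unitDisk) : EqOn (deriv f) (deriv g) unitDisk :=
  fun _ hz => (h.eventuallyEq_of_mem (isOpen_unitDisk.mem_nhds hz)).deriv_eq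

lemma wnorm_le {γ M : ℝ} {g : ℂ → ℂ} (h : ∀ z ∈ unitDisk, (1 - ‖z‖ ^ 2) ^ γ * ‖g z‖ ≤ M) :
    wnorm γ g ≤ M := by
  apply csSup_le
  · exact ⟨_, 0, zero_mem_unitDisk, rfl⟩
  · rintro _ ⟨z, hz, rfl⟩
    exact h z hz

lemma le_wnorm {γ : ℝ} {g : ℂ → ℂ}
    (h : BddAbove ((fun z => (1 - ‖z‖ ^ 2) ^ γ * ‖g z‖) '' unitDisk)) {z : ℂ}
    (hz : z ∈ unitDisk) : (1 - ‖z‖ ^ 2) ^ γ * ‖g z‖ ≤ wnorm γ g :=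
  le_csSup h ⟨z, hz, rfl⟩

lemma bddAbove_weighted {γ M : ℝ} {g : ℂ → ℂ}
    (h : ∀ z ∈ unitDisk, (1 - ‖z‖ ^ 2) ^ γ * ‖g z‖ ≤ M) :
    BddAbove ((fun z => (1 - ‖z‖ ^ 2) ^ γ * ‖g z‖) '' unitDisk) := by
  refine ⟨M, ?_⟩
  rintro _ ⟨z, hz, rfl⟩
  exact h z hz

lemma wnorm_nonneg (γ : ℝ) (g : ℂ → ℂ) : 0 ≤ wnorm γ g := by
  apply Real.sSup_nonneg
  rintro _ ⟨z, hz, rfl⟩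
  exact mul_nonneg (Real.rpow_nonneg (one_sub_norm_sq_pos hz).le _) (norm_nonneg _)

lemma blochNorm_nonneg (α : ℝ) (f : ℂ → ℂ) : 0 ≤ blochNorm α f :=
  add_nonneg (norm_nonneg _) (wnorm_nonneg _ _)

lemma zygNorm_nonneg (β : ℝ) (f : ℂ → ℂ) : 0 ≤ zygNorm β f :=
  add_nonneg (add_nonneg (norm_nonneg _) (norm_nonneg _)) (wnorm_nonneg _ _)

lemma MemBloch.weighted_deriv_le {α : ℝ} {f : ℂ → ℂ} (hf : MemBloch α f) {z : ℂ}
    (hz : z ∈ unitDisk) : (1 - ‖z‖ ^ 2) ^ α * ‖deriv f z‖ ≤ blochNorm α f :=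
  (le_wnorm hf.2 hz).trans (le_add_of_nonneg_left (norm_nonneg _))

lemma MemZygmund.weighted_deriv2_le {β : ℝ} {f : ℂ → ℂ} (hf : MemZygmund β f) {z : ℂ}
    (hz : z ∈ unitDisk) : (1 - ‖z‖ ^ 2) ^ β * ‖deriv (deriv f) z‖ ≤ zygNorm β f :=
  (le_wnorm hf.2 hz).trans (le_add_of_nonneg_left (by positivity))

lemma deriv_combo {f g : ℂ → ℂ} (hf : DifferentiableOn ℂ f unitDisk)
    (hg : DifferentiableOn ℂ g unitDisk) (a b : ℂ) :
    EqOn (deriv fun z => a * f z + b * g z) (fun z => a * deriv f z + b * deriv g z) unitDisk :=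
  fun _ hz => (((differentiableAt_of_mem hf hz).hasDerivAt.const_mul a).add
    ((differentiableAt_of_mem hg hz).hasDerivAt.const_mul b)).deriv

lemma differentiableOn_combo {f g : ℂ → ℂ} (hf : DifferentiableOn ℂ f unitDisk)
    (hg : DifferentiableOn ℂ g unitDisk) (a b : ℂ) :
    DifferentiableOn ℂ (fun z => a * f z + b * g z) unitDisk :=
  (hf.const_mul a).add (hg.const_mul b)

lemma deriv2_combo {f g : ℂ → ℂ} (hf : DifferentiableOn ℂ f unitDisk)
    (hg : DifferentiableOn ℂ g unitDisk) (a b : ℂ) :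
    EqOn (deriv (deriv fun z => a * f z + b * g z))
      (fun z => a * deriv (deriv f) z + b * deriv (deriv g) z) unitDisk :=
  (deriv_eq_of_eqOn (deriv_combo hf hg a b)).trans
    (deriv_combo (differentiableOn_deriv hf) (differentiableOn_deriv hg) a b)

lemma weighted_combo_le {w : ℝ} (hw : 0 ≤ w) (a b x y : ℂ) {p q : ℝ} (hx : w * ‖x‖ ≤ p)
    (hy : w * ‖y‖ ≤ q) : w * ‖a * x + b * y‖ ≤ ‖a‖ * p + ‖b‖ * q := by
  have h1 : ‖a * x + b * y‖ ≤ ‖a‖ * ‖x‖ + ‖b‖ * ‖y‖ := by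
    simpa only [norm_mul] using norm_add_le (a * x) (b * y)
  calc w * ‖a * x + b * y‖ ≤ w * (‖a‖ * ‖x‖ + ‖b‖ * ‖y‖) := by gcongr
    _ = ‖a‖ * (w * ‖x‖) + ‖b‖ * (w * ‖y‖) := by ring
    _ ≤ _ := by gcongr

lemma MemBloch.combo {α : ℝ} {f g : ℂ → ℂ} (hf : MemBloch α f) (hg : MemBloch α g) (a b : ℂ) :
    MemBloch α (fun z => a * f z + b * g z) ∧
      blochNorm α (fun z => a * f z + b * g z) ≤ ‖a‖ * blochNorm α f + ‖b‖ * blochNorm α g := by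
  have key : ∀ z ∈ unitDisk, (1 - ‖z‖ ^ 2) ^ α * ‖deriv (fun z => a * f z + b * g z) z‖ ≤
      ‖a‖ * wnorm α (deriv f) + ‖b‖ * wnorm α (deriv g) := by
    intro z hz
    rw [deriv_combo hf.1 hg.1 a b hz]
    exact weighted_combo_le (Real.rpow_nonneg (one_sub_norm_sq_pos hz).le _) _ _ _ _
      (le_wnorm hf.2 hz) (le_wnorm hg.2 hz)
  refine ⟨⟨differentiableOn_combo hf.1 hg.1 a b, bddAbove_weighted key⟩, ?_⟩
  have h1 := wnorm_le key
  have h2 := norm_add_le (a * f 0) (b * g 0)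
  simp only [norm_mul] at h2
  simp only [blochNorm]
  linarith

lemma MemZygmund.combo {β : ℝ} {f g : ℂ → ℂ} (hf : MemZygmund β f) (hg : MemZygmund β g)
    (a b : ℂ) :
    MemZygmund β (fun z => a * f z + b * g z) ∧
      zygNorm β (fun z => a * f z + b * g z) ≤ ‖a‖ * zygNorm β f + ‖b‖ * zygNorm β g := by
  have key : ∀ z ∈ unitDisk, (1 - ‖z‖ ^ 2) ^ β *
      ‖deriv (deriv fun z => a * f z + b * g z) z‖ ≤
      ‖a‖ * wnorm β (deriv (deriv f)) + ‖b‖ * wnorm β (deriv (deriv g)) := by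
    intro z hz
    rw [deriv2_combo hf.1 hg.1 a b hz]
    exact weighted_combo_le (Real.rpow_nonneg (one_sub_norm_sq_pos hz).le _) _ _ _ _
      (le_wnorm hf.2 hz) (le_wnorm hg.2 hz)
  refine ⟨⟨differentiableOn_combo hf.1 hg.1 a b, bddAbove_weighted key⟩, ?_⟩
  have h1 := wnorm_le key
  have h2 := norm_add_le (a * f 0) (b * g 0)
  have h3 := norm_add_le (a * deriv f 0) (b * deriv g 0)
  have h4 := deriv_combo hf.1 hg.1 a b zero_mem_unitDisk
  simp only [norm_mul] at h2 h3
  simp only [zygNorm, h4]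
  linarith

lemma MemZygmund.sub {β : ℝ} {f g : ℂ → ℂ} (hf : MemZygmund β f) (hg : MemZygmund β g) :
    MemZygmund β (fun z => f z - g z) ∧
      zygNorm β (fun z => f z - g z) ≤ zygNorm β f + zygNorm β g := by
  simpa [← sub_eq_add_neg] using hf.combo hg 1 (-1)

lemma MemZygmund.add {β : ℝ} {f g : ℂ → ℂ} (hf : MemZygmund β f) (hg : MemZygmund β g) :
    MemZygmund β (fun z => f z + g z) ∧
      zygNorm β (fun z => f z + g z) ≤ zygNorm β f + zygNorm β g := by
  simpa using hf.combo hg 1 1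

lemma MemBloch.sub {α : ℝ} {f g : ℂ → ℂ} (hf : MemBloch α f) (hg : MemBloch α g) :
    MemBloch α (fun z => f z - g z) ∧
      blochNorm α (fun z => f z - g z) ≤ blochNorm α f + blochNorm α g := by
  simpa [← sub_eq_add_neg] using hf.combo hg 1 (-1)

lemma MemBloch.const_mul {α : ℝ} {f : ℂ → ℂ} (hf : MemBloch α f) (a : ℂ) :
    MemBloch α (fun z => a * f z) ∧
      blochNorm α (fun z => a * f z) ≤ ‖a‖ * blochNorm α f := by
  simpa using hf.combo hf a 0

lemma wcomp_sub (u φ f g : ℂ → ℂ) :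
    wcomp u φ (fun z => f z - g z) = fun z => wcomp u φ f z - wcomp u φ g z := by
  funext z
  simp only [wcomp]
  ring

/-- The coefficient of `f' ∘ φ` in the second derivative of `u · (f ∘ φ)`. -/
def firstCoeff (u φ : ℂ → ℂ) (z : ℂ) : ℂ := 2 * deriv u z * deriv φ z + u z * deriv (deriv φ) z

/-- The coefficient of `f'' ∘ φ` in the second derivative of `u · (f ∘ φ)`. -/
def secondCoeff (u φ : ℂ → ℂ) (z : ℂ) : ℂ := u z * deriv φ z ^ 2

lemma deriv_wcomp {u φ f : ℂ → ℂ} (hu : DifferentiableOn ℂ u unitDisk)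
    (hφ : DifferentiableOn ℂ φ unitDisk) (hm : MapsTo φ unitDisk unitDisk)
    (hf : DifferentiableOn ℂ f unitDisk) :
    EqOn (deriv (wcomp u φ f))
      (fun z => deriv u z * f (φ z) + u z * (deriv f (φ z) * deriv φ z)) unitDisk :=
  fun _ hz => ((differentiableAt_of_mem hu hz).hasDerivAt.mul
    ((differentiableAt_of_mem hf (hm hz)).hasDerivAt.comp _
      (differentiableAt_of_mem hφ hz).hasDerivAt)).deriv

lemma deriv2_wcomp {u φ f : ℂ → ℂ} (hu : DifferentiableOn ℂ u unitDisk)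
    (hφ : DifferentiableOn ℂ φ unitDisk) (hm : MapsTo φ unitDisk unitDisk)
    (hf : DifferentiableOn ℂ f unitDisk) {z : ℂ} (hz : z ∈ unitDisk) :
    deriv (deriv (wcomp u φ f)) z = deriv (deriv u) z * f (φ z) +
      (firstCoeff u φ z * deriv f (φ z) + secondCoeff u φ z * deriv (deriv f) (φ z)) := by
  rw [deriv_eq_of_eqOn (deriv_wcomp hu hφ hm hf) hz]
  have hu1 := (differentiableAt_of_mem hu hz).hasDerivAt
  have hu2 := (differentiableAt_of_mem (differentiableOn_deriv hu) hz).hasDerivAt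
  have hp1 := (differentiableAt_of_mem hφ hz).hasDerivAt
  have hp2 := (differentiableAt_of_mem (differentiableOn_deriv hφ) hz).hasDerivAt
  have hf1 := (differentiableAt_of_mem hf (hm hz)).hasDerivAt.comp z hp1
  have hf2 := (differentiableAt_of_mem (differentiableOn_deriv hf) (hm hz)).hasDerivAt.comp z hp1
  have := ((hu2.mul hf1).add (hu1.mul (hf2.mul hp2))).deriv
  refine Eq.trans this ?_
  simp only [firstCoeff, secondCoeff, Function.comp_apply, Pi.mul_apply]
  ring

/-- Cauchy estimate in weighted form. -/
lemma weighted_deriv_le_of_weighted_le {γ N : ℝ} (hγ : 0 ≤ γ) {h : ℂ → ℂ}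
    (hh : DifferentiableOn ℂ h unitDisk)
    (hN : ∀ z ∈ unitDisk, (1 - ‖z‖ ^ 2) ^ γ * ‖h z‖ ≤ N) {z : ℂ} (hz : z ∈ unitDisk) :
    (1 - ‖z‖ ^ 2) ^ (γ + 1) * ‖deriv h z‖ ≤ 4 ^ (γ + 1) * N := by
  have hz1 := norm_lt_one_of_mem hz
  have hd := one_sub_norm_sq_pos hz
  set d := 1 - ‖z‖ ^ 2 with hd_def
  have hR : 0 < (1 - ‖z‖) / 2 := by linarith
  have hsub : Metric.closedBall z ((1 - ‖z‖) / 2) ⊆ unitDisk := by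
    intro w hw
    apply mem_unitDisk_of_norm_lt
    have h1 : ‖w - z‖ ≤ (1 - ‖z‖) / 2 := by simpa [dist_eq_norm] using hw
    have h2 : ‖w‖ ≤ ‖w - z‖ + ‖z‖ := by simpa using norm_add_le (w - z) z
    linarith
  have hRd : d / 4 ≤ (1 - ‖z‖) / 2 := by
    rw [hd_def]
    nlinarith [norm_nonneg z]
  have hdc : DiffContOnCl ℂ h (Metric.ball z ((1 - ‖z‖) / 2)) := by
    apply DifferentiableOn.diffContOnCl
    exact hh.mono ((Metric.closure_ball_subset_closedBall).trans hsub)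
  have hN0 : 0 ≤ N := (mul_nonneg (Real.rpow_nonneg hd.le _) (norm_nonneg _)).trans (hN z hz)
  have hd4 : 0 < (d / 4) ^ γ := Real.rpow_pos_of_pos (by positivity) _
  have hC : ∀ w ∈ Metric.sphere z ((1 - ‖z‖) / 2), ‖h w‖ ≤ N / (d / 4) ^ γ := by
    intro w hw
    have hwD := hsub (Metric.sphere_subset_closedBall hw)
    rw [le_div_iff₀ hd4]
    refine le_trans ?_ (hN w hwD)
    rw [mul_comm]
    gcongr
    have h1 : ‖w - z‖ = (1 - ‖z‖) / 2 := by simpa [dist_eq_norm] using hw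
    have h2 : ‖w‖ ≤ ‖w - z‖ + ‖z‖ := by simpa using norm_add_le (w - z) z
    nlinarith [norm_nonneg w, norm_lt_one_of_mem hwD, norm_nonneg z]
  have := Complex.norm_deriv_le_of_forall_mem_sphere_norm_le hR hdc hC
  have h3 : N / (d / 4) ^ γ / ((1 - ‖z‖) / 2) ≤ N / (d / 4) ^ γ / (d / 4) := by gcongr
  have h4 : N / (d / 4) ^ γ / (d / 4) = N / (d / 4) ^ (γ + 1) := by
    rw [Real.rpow_add_one (by positivity), div_div]
  have h5 : (d / 4) ^ (γ + 1) = d ^ (γ + 1) / 4 ^ (γ + 1) := Real.div_rpow hd.le (by norm_num) _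
  have hdp : 0 < d ^ (γ + 1) := Real.rpow_pos_of_pos hd _
  calc d ^ (γ + 1) * ‖deriv h z‖ ≤ d ^ (γ + 1) * (N / (d / 4) ^ (γ + 1)) := by
        gcongr
        rw [← h4]
        exact this.trans h3
    _ = _ := by
        rw [h5]
        field_simp

lemma MemBloch.norm_sub_dilate_le {α : ℝ} (hα0 : 0 < α) (hα1 : α < 1) {f : ℂ → ℂ}
    (hf : MemBloch α f) {z : ℂ} (hz : z ∈ unitDisk) {r : ℝ} (hr0 : 0 ≤ r) (hr1 : r ≤ 1) :
    ‖f z - f (r * z)‖ ≤ blochNorm α f / (1 - α) * (1 - r) ^ (1 - α) := by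
  have hz1 := norm_lt_one_of_mem hz
  have hα : 0 < 1 - α := by linarith
  set N := blochNorm α f with hN
  have hN0 : 0 ≤ N := blochNorm_nonneg _ _
  have hmem : ∀ t ∈ Icc r 1, (t : ℂ) * z ∈ unitDisk := by
    intro t ht
    apply mem_unitDisk_of_norm_lt
    rw [norm_mul, Complex.norm_real, Real.norm_of_nonneg (hr0.trans ht.1)]
    nlinarith [ht.2, norm_nonneg z]
  have hderiv : ∀ t ∈ Icc r 1, HasDerivAt (fun t : ℝ => f (t * z) - f (r * z))
      (deriv f (t * z) * z) t := by
    intro t ht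
    have h1 : HasDerivAt (fun s : ℂ => f (s * z)) (deriv f (t * z) * z) (t : ℂ) := by
      have h0 : HasDerivAt (fun s : ℂ => s * z) z (t : ℂ) := by
        simpa using (hasDerivAt_id (t : ℂ)).mul_const z
      exact (differentiableAt_of_mem hf.1 (hmem t ht)).hasDerivAt.comp (t : ℂ) h0
    exact h1.comp_ofReal.sub_const _
  have hpos : ∀ t ∈ Icc r 1, 0 < 1 - t * ‖z‖ := by
    intro t ht
    nlinarith [ht.1, ht.2, norm_nonneg z]
  have hB : ∀ t ∈ Icc r 1, HasDerivAt
      (fun t : ℝ => N / (1 - α) * ((1 - r * ‖z‖) ^ (1 - α) - (1 - t * ‖z‖) ^ (1 - α)))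
      (N * ‖z‖ * (1 - t * ‖z‖) ^ (-α)) t := by
    intro t ht
    have h0 : HasDerivAt (fun t : ℝ => 1 - t * ‖z‖) (-‖z‖) t := by
      simpa using ((hasDerivAt_id t).mul_const ‖z‖).const_sub 1
    have h1 := ((h0.rpow_const (p := 1 - α) (Or.inl (hpos t ht).ne')).const_sub
      ((1 - r * ‖z‖) ^ (1 - α))).const_mul (N / (1 - α))
    refine h1.congr_deriv ?_
    rw [show 1 - α - 1 = -α by ring]
    field_simp
  have hr : r ∈ Icc r 1 := ⟨le_rfl, hr1⟩
  have h1 : (1 : ℝ) ∈ Icc r 1 := ⟨hr1, le_rfl⟩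
  have key := image_norm_le_of_norm_deriv_right_le_deriv_boundary'
    (f := fun t : ℝ => f (t * z) - f (r * z)) (f' := fun t : ℝ => deriv f (t * z) * z)
    (a := r) (b := 1)
    (fun t ht => (hderiv t ht).continuousAt.continuousWithinAt)
    (fun t ht => (hderiv t ⟨ht.1, ht.2.le⟩).hasDerivWithinAt)
    (B := fun t : ℝ => N / (1 - α) * ((1 - r * ‖z‖) ^ (1 - α) - (1 - t * ‖z‖) ^ (1 - α)))
    (B' := fun t : ℝ => N * ‖z‖ * (1 - t * ‖z‖) ^ (-α))
    (by simp)
    (fun t ht => (hB t ht).continuousAt.continuousWithinAt)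
    (fun t ht => (hB t ⟨ht.1, ht.2.le⟩).hasDerivWithinAt)
    (by
      intro t ht
      have ht' : t ∈ Icc r 1 := ⟨ht.1, ht.2.le⟩
      have h2 := hf.weighted_deriv_le (hmem t ht')
      have h3 := hpos t ht'
      have h4 : 1 - t * ‖z‖ ≤ 1 - ‖(t : ℂ) * z‖ ^ 2 := by
        rw [norm_mul, Complex.norm_real, Real.norm_of_nonneg (hr0.trans ht.1)]
        have : 0 ≤ t * ‖z‖ := mul_nonneg (hr0.trans ht.1) (norm_nonneg _)
        nlinarith
      have h5 : (1 - t * ‖z‖) ^ α * ‖deriv f (t * z)‖ ≤ N := by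
        refine le_trans ?_ h2
        gcongr
      rw [norm_mul, Real.rpow_neg h3.le, ← div_eq_mul_inv,
        le_div_iff₀ (Real.rpow_pos_of_pos h3 _)]
      calc _ = ‖z‖ * ((1 - t * ‖z‖) ^ α * ‖deriv f (t * z)‖) := by ring
        _ ≤ ‖z‖ * N := by gcongr
        _ = _ := by ring)
    h1
  simp only [ofReal_one, one_mul] at key
  refine key.trans ?_
  gcongr
  have h6 := hpos 1 h1
  have h7 : 0 ≤ (1 - r) * ‖z‖ := mul_nonneg (by linarith) (norm_nonneg _)
  have h8 := Real.rpow_add_le_add_rpow (p := 1 - α) h7 h6.le hα.le (by linarith)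
  rw [show (1 - r) * ‖z‖ + (1 - 1 * ‖z‖) = 1 - r * ‖z‖ by ring, one_mul] at h8
  have h9 : ((1 - r) * ‖z‖) ^ (1 - α) ≤ (1 - r) ^ (1 - α) := by
    gcongr
    nlinarith
  linarith

lemma MemBloch.norm_le {α : ℝ} (hα0 : 0 < α) (hα1 : α < 1) {f : ℂ → ℂ}
    (hf : MemBloch α f) {z : ℂ} (hz : z ∈ unitDisk) :
    ‖f z‖ ≤ (1 + 1 / (1 - α)) * blochNorm α f := by
  have h1 := hf.norm_sub_dilate_le hα0 hα1 hz le_rfl zero_le_one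
  simp only [ofReal_zero, zero_mul, sub_zero, Real.one_rpow, mul_one] at h1
  have h2 : ‖f 0‖ ≤ blochNorm α f := le_add_of_nonneg_right (wnorm_nonneg _ _)
  have h3 : ‖f z‖ ≤ ‖f z - f 0‖ + ‖f 0‖ := by simpa using norm_add_le (f z - f 0) (f 0)
  calc ‖f z‖ ≤ blochNorm α f / (1 - α) + blochNorm α f := by linarith
    _ = _ := by ring

/-- The normalized Cauchy kernel `(1 - |a|²) / (1 - \bar a z)`. -/
def kernelFn (a z : ℂ) : ℂ := ((1 - ‖a‖ ^ 2 : ℝ) : ℂ) / (1 - (starRingEnd ℂ) a * z)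

lemma one_sub_norm_le_norm_denom {a z : ℂ} (hz : z ∈ unitDisk) :
    1 - ‖a‖ ≤ ‖1 - (starRingEnd ℂ) a * z‖ := by
  have h1 := norm_sub_norm_le 1 ((starRingEnd ℂ) a * z)
  rw [norm_one, norm_mul, Complex.norm_conj] at h1
  nlinarith [norm_nonneg a, norm_nonneg z, norm_lt_one_of_mem hz]

lemma denom_pos {a z : ℂ} (ha : a ∈ unitDisk) (hz : z ∈ unitDisk) :
    0 < ‖1 - (starRingEnd ℂ) a * z‖ :=
  (sub_pos.2 (norm_lt_one_of_mem ha)).trans_le (one_sub_norm_le_norm_denom hz)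

lemma norm_kernelFn {a : ℂ} (ha : a ∈ unitDisk) (z : ℂ) :
    ‖kernelFn a z‖ = (1 - ‖a‖ ^ 2) / ‖1 - (starRingEnd ℂ) a * z‖ := by
  rw [kernelFn, norm_div, Complex.norm_real, Real.norm_of_nonneg (one_sub_norm_sq_pos ha).le]

lemma norm_kernelFn_le {a z : ℂ} (ha : a ∈ unitDisk) (hz : z ∈ unitDisk) :
    ‖kernelFn a z‖ ≤ 2 := by
  rw [norm_kernelFn ha, div_le_iff₀ (denom_pos ha hz)]
  nlinarith [one_sub_norm_le_norm_denom (a := a) hz, norm_nonneg a, norm_lt_one_of_mem ha]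

lemma mul_norm_kernelFn_le {a z : ℂ} (ha : a ∈ unitDisk) (hz : z ∈ unitDisk) :
    (1 - ‖z‖ ^ 2) / (1 - ‖a‖ ^ 2) * ‖kernelFn a z‖ ≤ 2 := by
  have hd := (one_sub_norm_sq_pos ha).ne'
  have hp := denom_pos ha hz
  rw [norm_kernelFn ha, div_mul_div_comm, mul_comm (1 - ‖a‖ ^ 2), mul_div_mul_right _ _ hd,
    div_le_iff₀ hp]
  have h1 : 1 - ‖z‖ ≤ ‖1 - (starRingEnd ℂ) a * z‖ := by
    have h1 := norm_sub_norm_le 1 ((starRingEnd ℂ) a * z)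
    rw [norm_one, norm_mul, Complex.norm_conj] at h1
    nlinarith [norm_nonneg a, norm_nonneg z, norm_lt_one_of_mem ha]
  nlinarith [norm_nonneg z, norm_lt_one_of_mem hz]

lemma kernelFn_self {a : ℂ} (ha : a ∈ unitDisk) : kernelFn a a = 1 := by
  have hd := (one_sub_norm_sq_pos ha).ne'
  rw [kernelFn, mul_comm, Complex.mul_conj, Complex.normSq_eq_norm_sq]
  push_cast
  apply div_self
  exact_mod_cast hd

lemma hasDerivAt_kernelFn {a z : ℂ} (ha : a ∈ unitDisk) (hz : z ∈ unitDisk) :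
    HasDerivAt (kernelFn a)
      ((starRingEnd ℂ) a / ((1 - ‖a‖ ^ 2 : ℝ) : ℂ) * kernelFn a z ^ 2) z := by
  have hd : ((1 - ‖a‖ ^ 2 : ℝ) : ℂ) ≠ 0 := by exact_mod_cast (one_sub_norm_sq_pos ha).ne'
  have hp : 1 - (starRingEnd ℂ) a * z ≠ 0 := norm_pos_iff.1 (denom_pos ha hz)
  have h0 : HasDerivAt (fun z : ℂ => 1 - (starRingEnd ℂ) a * z) (-(starRingEnd ℂ) a) z := by
    simpa using ((hasDerivAt_id z).const_mul ((starRingEnd ℂ) a)).const_sub 1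
  have h1 := (hasDerivAt_const z ((1 - ‖a‖ ^ 2 : ℝ) : ℂ)).div h0 hp
  refine h1.congr_deriv ?_
  simp only [kernelFn]
  field_simp
  ring

/-- Test functions `(1 - |a|²)^{1-α} (x (σ - 1) + y (σ - 1)²)`, `σ` the normalized kernel. -/
def testFn (α : ℝ) (a x y z : ℂ) : ℂ :=
  (((1 - ‖a‖ ^ 2) ^ (1 - α) : ℝ) : ℂ) *
    (x * (kernelFn a z - 1) + y * (kernelFn a z - 1) ^ 2)

/-- The derivative of `testFn` on the disk. -/
def testFnDeriv (α : ℝ) (a x y z : ℂ) : ℂ :=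
  (((1 - ‖a‖ ^ 2) ^ (-α) : ℝ) : ℂ) * (starRingEnd ℂ) a *
    ((x + 2 * y * (kernelFn a z - 1)) * kernelFn a z ^ 2)

/-- The second derivative of `testFn` on the disk. -/
def testFnDeriv2 (α : ℝ) (a x y z : ℂ) : ℂ :=
  (((1 - ‖a‖ ^ 2) ^ (-(α + 1)) : ℝ) : ℂ) * (starRingEnd ℂ) a ^ 2 *
    (2 * y * kernelFn a z ^ 4 + 2 * (x + 2 * y * (kernelFn a z - 1)) * kernelFn a z ^ 3)

lemma hasDerivAt_testFn {α : ℝ} {a z : ℂ} (ha : a ∈ unitDisk) (hz : z ∈ unitDisk) (x y : ℂ) :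
    HasDerivAt (testFn α a x y) (testFnDeriv α a x y z) z := by
  have hd := one_sub_norm_sq_pos ha
  have hd' : ((1 - ‖a‖ ^ 2 : ℝ) : ℂ) ≠ 0 := by exact_mod_cast hd.ne'
  have h0 := (hasDerivAt_kernelFn ha hz).sub_const 1
  have h1 := ((h0.const_mul x).add ((h0.pow 2).const_mul y)).const_mul
    (((1 - ‖a‖ ^ 2) ^ (1 - α) : ℝ) : ℂ)
  refine h1.congr_deriv ?_
  rw [show (1 : ℝ) - α = -α + 1 by ring, Real.rpow_add_one hd.ne', testFnDeriv, ofReal_mul]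
  simp only [Nat.cast_ofNat, Nat.reduceSub, pow_one]
  field_simp

lemma hasDerivAt_testFnDeriv {α : ℝ} {a z : ℂ} (ha : a ∈ unitDisk) (hz : z ∈ unitDisk)
    (x y : ℂ) : HasDerivAt (testFnDeriv α a x y) (testFnDeriv2 α a x y z) z := by
  have hd := one_sub_norm_sq_pos ha
  have hd' : ((1 - ‖a‖ ^ 2 : ℝ) : ℂ) ≠ 0 := by exact_mod_cast hd.ne'
  have h0 := hasDerivAt_kernelFn ha hz
  have h1 := ((((h0.sub_const 1).const_mul (2 * y)).const_add x).mul (h0.pow 2)).const_mul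
    ((((1 - ‖a‖ ^ 2) ^ (-α) : ℝ) : ℂ) * (starRingEnd ℂ) a)
  refine h1.congr_deriv ?_
  rw [show -α = -(α + 1) + 1 by ring, Real.rpow_add_one hd.ne', testFnDeriv2, ofReal_mul]
  simp only [Nat.cast_ofNat, Nat.reduceSub, pow_one, Pi.pow_apply]
  field_simp

lemma deriv_testFn {α : ℝ} {a : ℂ} (ha : a ∈ unitDisk) (x y : ℂ) :
    EqOn (deriv (testFn α a x y)) (testFnDeriv α a x y) unitDisk :=
  fun _ hz => (hasDerivAt_testFn ha hz x y).deriv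

lemma deriv2_testFn {α : ℝ} {a : ℂ} (ha : a ∈ unitDisk) (x y : ℂ) :
    EqOn (deriv (deriv (testFn α a x y))) (testFnDeriv2 α a x y) unitDisk :=
  fun _ hz => (deriv_eq_of_eqOn (deriv_testFn ha x y) hz).trans
    (hasDerivAt_testFnDeriv ha hz x y).deriv

section TestFnBounds

variable {α : ℝ} {a z x y : ℂ}

lemma norm_kernelFn_sub_one_le (ha : a ∈ unitDisk) (hz : z ∈ unitDisk) :
    ‖kernelFn a z - 1‖ ≤ 3 := by
  have := norm_sub_le (kernelFn a z) 1
  rw [norm_one] at this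
  linarith [norm_kernelFn_le ha hz]

lemma norm_linear_part_le (ha : a ∈ unitDisk) (hz : z ∈ unitDisk) (hx : ‖x‖ ≤ 1)
    (hy : ‖y‖ ≤ 1) : ‖x + 2 * y * (kernelFn a z - 1)‖ ≤ 7 := by
  have h1 := norm_kernelFn_sub_one_le ha hz
  calc _ ≤ ‖x‖ + ‖2 * y * (kernelFn a z - 1)‖ := norm_add_le _ _
    _ = ‖x‖ + 2 * ‖y‖ * ‖kernelFn a z - 1‖ := by simp
    _ ≤ 1 + 2 * 1 * 3 := by gcongr
    _ = 7 := by norm_num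

lemma norm_testFn_le (ha : a ∈ unitDisk) (hz : z ∈ unitDisk) (hx : ‖x‖ ≤ 1) (hy : ‖y‖ ≤ 1) :
    ‖testFn α a x y z‖ ≤ 12 * (1 - ‖a‖ ^ 2) ^ (1 - α) := by
  have h1 := norm_kernelFn_sub_one_le ha hz
  have hd := one_sub_norm_sq_pos ha
  rw [testFn, norm_mul, Complex.norm_real, Real.norm_of_nonneg (by positivity), mul_comm]
  gcongr
  calc _ ≤ ‖x * (kernelFn a z - 1)‖ + ‖y * (kernelFn a z - 1) ^ 2‖ := norm_add_le _ _
    _ = ‖x‖ * ‖kernelFn a z - 1‖ + ‖y‖ * ‖kernelFn a z - 1‖ ^ 2 := by simp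
    _ ≤ 1 * 3 + 1 * 3 ^ 2 := by gcongr
    _ = 12 := by norm_num

lemma norm_testFnDeriv_le_mul (ha : a ∈ unitDisk) (hz : z ∈ unitDisk) (hx : ‖x‖ ≤ 1)
    (hy : ‖y‖ ≤ 1) :
    ‖testFnDeriv α a x y z‖ ≤ (1 - ‖a‖ ^ 2) ^ (-α) * (7 * ‖kernelFn a z‖ ^ 2) := by
  have hd := one_sub_norm_sq_pos ha
  have h1 := norm_linear_part_le ha hz hx hy
  have h2 := (norm_lt_one_of_mem ha).le
  rw [testFnDeriv, norm_mul, norm_mul, norm_mul, norm_pow, Complex.norm_real, Complex.norm_conj,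
    Real.norm_of_nonneg (by positivity)]
  calc _ ≤ (1 - ‖a‖ ^ 2) ^ (-α) * 1 * (7 * ‖kernelFn a z‖ ^ 2) := by gcongr
    _ = _ := by ring

lemma norm_testFnDeriv_le (ha : a ∈ unitDisk) (hz : z ∈ unitDisk) (hx : ‖x‖ ≤ 1)
    (hy : ‖y‖ ≤ 1) : ‖testFnDeriv α a x y z‖ ≤ 28 * (1 - ‖a‖ ^ 2) ^ (-α) := by
  have hd := one_sub_norm_sq_pos ha
  have h1 := norm_kernelFn_le ha hz
  calc _ ≤ (1 - ‖a‖ ^ 2) ^ (-α) * (7 * ‖kernelFn a z‖ ^ 2) :=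
        norm_testFnDeriv_le_mul ha hz hx hy
    _ ≤ (1 - ‖a‖ ^ 2) ^ (-α) * (7 * 2 ^ 2) := by gcongr
    _ = _ := by ring

lemma norm_testFnDeriv2_le (ha : a ∈ unitDisk) (hz : z ∈ unitDisk) (hx : ‖x‖ ≤ 1)
    (hy : ‖y‖ ≤ 1) : ‖testFnDeriv2 α a x y z‖ ≤ 144 * (1 - ‖a‖ ^ 2) ^ (-(α + 1)) := by
  have hd := one_sub_norm_sq_pos ha
  have h1 := norm_linear_part_le ha hz hx hy
  have h2 := (norm_lt_one_of_mem ha).le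
  have h3 := norm_kernelFn_le ha hz
  rw [testFnDeriv2, norm_mul, norm_mul, norm_pow, Complex.norm_real, Complex.norm_conj,
    Real.norm_of_nonneg (by positivity)]
  have h4 : ‖2 * y * kernelFn a z ^ 4 + 2 * (x + 2 * y * (kernelFn a z - 1)) *
      kernelFn a z ^ 3‖ ≤ 144 := by
    calc _ ≤ ‖2 * y * kernelFn a z ^ 4‖ +
          ‖2 * (x + 2 * y * (kernelFn a z - 1)) * kernelFn a z ^ 3‖ := norm_add_le _ _
      _ = 2 * ‖y‖ * ‖kernelFn a z‖ ^ 4 +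
          2 * ‖x + 2 * y * (kernelFn a z - 1)‖ * ‖kernelFn a z‖ ^ 3 := by
          simp only [norm_mul, norm_pow, RCLike.norm_ofNat]
      _ ≤ 2 * 1 * 2 ^ 4 + 2 * 7 * 2 ^ 3 := by gcongr
      _ = 144 := by norm_num
  calc _ ≤ (1 - ‖a‖ ^ 2) ^ (-(α + 1)) * 1 ^ 2 * 144 := by gcongr
    _ = _ := by ring

lemma memBloch_testFn (hα0 : 0 < α) (hα1 : α < 1) (ha : a ∈ unitDisk) (hx : ‖x‖ ≤ 1)
    (hy : ‖y‖ ≤ 1) : MemBloch α (testFn α a x y) ∧ blochNorm α (testFn α a x y) ≤ 68 := by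
  have hd := one_sub_norm_sq_pos ha
  have key : ∀ z ∈ unitDisk, (1 - ‖z‖ ^ 2) ^ α * ‖deriv (testFn α a x y) z‖ ≤ 56 := by
    intro z hz
    have hz' := one_sub_norm_sq_pos hz
    rw [deriv_testFn ha x y hz]
    set q := (1 - ‖z‖ ^ 2) / (1 - ‖a‖ ^ 2) with hq
    have hq0 : 0 < q := by positivity
    have hqα : q ^ α ≤ 1 + q := by
      have h := Real.rpow_add_le_add_rpow (p := 1) zero_le_one hq0.le zero_le_one le_rfl
      calc q ^ α ≤ (1 + q) ^ α := by gcongr; linarith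
        _ ≤ (1 + q) ^ (1 : ℝ) := Real.rpow_le_rpow_of_exponent_le (by linarith) hα1.le
        _ = 1 + q := Real.rpow_one _
    have h1 := norm_kernelFn_le ha hz
    have h2 : q * ‖kernelFn a z‖ ≤ 2 := mul_norm_kernelFn_le ha hz
    have h3 : (1 - ‖z‖ ^ 2) ^ α * (1 - ‖a‖ ^ 2) ^ (-α) = q ^ α := by
      rw [hq, Real.div_rpow hz'.le hd.le, Real.rpow_neg hd.le, div_eq_mul_inv]
    calc _ ≤ (1 - ‖z‖ ^ 2) ^ α * ((1 - ‖a‖ ^ 2) ^ (-α) * (7 * ‖kernelFn a z‖ ^ 2)) := by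
          gcongr
          exact norm_testFnDeriv_le_mul ha hz hx hy
      _ = 7 * (q ^ α * ‖kernelFn a z‖ ^ 2) := by rw [← h3]; ring
      _ ≤ 7 * ((1 + q) * ‖kernelFn a z‖ ^ 2) := by gcongr
      _ = 7 * (‖kernelFn a z‖ ^ 2 + q * ‖kernelFn a z‖ * ‖kernelFn a z‖) := by ring
      _ ≤ 7 * (2 ^ 2 + 2 * 2) := by gcongr
      _ = 56 := by norm_num
  refine ⟨⟨fun z hz => (hasDerivAt_testFn ha hz x y).differentiableAt.differentiableWithinAt,
    bddAbove_weighted key⟩, ?_⟩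
  have h0 := norm_testFn_le (α := α) ha zero_mem_unitDisk hx hy
  have h1 : (1 - ‖a‖ ^ 2) ^ (1 - α) ≤ 1 :=
    Real.rpow_le_one hd.le (one_sub_norm_sq_le a) (by linarith)
  have h2 := wnorm_le key
  rw [blochNorm]
  linarith

lemma testFn_self (ha : a ∈ unitDisk) : testFn α a x y a = 0 := by
  simp [testFn, kernelFn_self ha]

lemma testFnDeriv_self (ha : a ∈ unitDisk) : testFnDeriv α a x y a =
    (((1 - ‖a‖ ^ 2) ^ (-α) : ℝ) : ℂ) * (starRingEnd ℂ) a * x := by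
  simp [testFnDeriv, kernelFn_self ha]

lemma testFnDeriv2_self (ha : a ∈ unitDisk) : testFnDeriv2 α a x y a =
    (((1 - ‖a‖ ^ 2) ^ (-(α + 1)) : ℝ) : ℂ) * (starRingEnd ℂ) a ^ 2 * (2 * y + 2 * x) := by
  simp [testFnDeriv2, kernelFn_self ha]

end TestFnBounds

lemma weighted_second_deriv_le {β : ℝ} {u φ f : ℂ → ℂ} (hu : DifferentiableOn ℂ u unitDisk)
    (hφ : DifferentiableOn ℂ φ unitDisk) (hm : MapsTo φ unitDisk unitDisk)
    (hf : DifferentiableOn ℂ f unitDisk) (hw : MemZygmund β (wcomp u φ f)) {z : ℂ}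
    (hz : z ∈ unitDisk) :
    (1 - ‖z‖ ^ 2) ^ β * ‖deriv (deriv u) z * f (φ z) +
      (firstCoeff u φ z * deriv f (φ z) + secondCoeff u φ z * deriv (deriv f) (φ z))‖ ≤
      zygNorm β (wcomp u φ f) := by
  rw [← deriv2_wcomp hu hφ hm hf hz]
  exact hw.weighted_deriv2_le hz

lemma memBloch_of_norm_deriv_le {α M : ℝ} (hα : 0 ≤ α) {f : ℂ → ℂ}
    (hf : DifferentiableOn ℂ f unitDisk) (hM : ∀ z ∈ unitDisk, ‖deriv f z‖ ≤ M) :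
    MemBloch α f ∧ blochNorm α f ≤ ‖f 0‖ + M := by
  have key : ∀ z ∈ unitDisk, (1 - ‖z‖ ^ 2) ^ α * ‖deriv f z‖ ≤ M := by
    intro z hz
    have h1 := Real.rpow_le_one (one_sub_norm_sq_pos hz).le (one_sub_norm_sq_le z) hα
    calc _ ≤ 1 * ‖deriv f z‖ := by gcongr
      _ ≤ M := by rw [one_mul]; exact hM z hz
  exact ⟨⟨hf, bddAbove_weighted key⟩, add_le_add_right (wnorm_le key) _⟩

lemma hasDerivAt_sub_const_sq (a z : ℂ) :
    HasDerivAt (fun z : ℂ => (z - a) ^ 2) (2 * (z - a)) z :=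
  (((hasDerivAt_id z).sub_const a).pow 2).congr_deriv (by simp)

/-- The weighted value at `φ z` of the operator on the test function centred at `φ z`. -/
def testValue (α β : ℝ) (u φ : ℂ → ℂ) (x y z : ℂ) : ℝ :=
  (1 - ‖z‖ ^ 2) ^ β * ‖firstCoeff u φ z * testFnDeriv α (φ z) x y (φ z) +
    secondCoeff u φ z * testFnDeriv2 α (φ z) x y (φ z)‖

lemma testValue_le {α β : ℝ} {u φ : ℂ → ℂ} (hu : DifferentiableOn ℂ u unitDisk)
    (hφ : DifferentiableOn ℂ φ unitDisk) (hm : MapsTo φ unitDisk unitDisk) {x y z : ℂ}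
    (hz : z ∈ unitDisk) (hw : MemZygmund β (wcomp u φ (testFn α (φ z) x y))) :
    testValue α β u φ x y z ≤ zygNorm β (wcomp u φ (testFn α (φ z) x y)) := by
  have ha := hm hz
  have h := weighted_second_deriv_le hu hφ hm
    (fun w hw => (hasDerivAt_testFn (α := α) ha hw x y).differentiableAt.differentiableWithinAt)
    hw hz
  rwa [testFn_self ha, deriv_testFn ha x y ha, deriv2_testFn ha x y ha, mul_zero, zero_add] at h

/-- The first of the two weighted quantities. -/
def firstQuot (α β : ℝ) (u φ : ℂ → ℂ) (z : ℂ) : ℝ :=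
  (1 - ‖z‖ ^ 2) ^ β * ‖firstCoeff u φ z‖ / (1 - ‖φ z‖ ^ 2) ^ α

/-- The second of the two weighted quantities. -/
def secondQuot (α β : ℝ) (u φ : ℂ → ℂ) (z : ℂ) : ℝ :=
  (1 - ‖z‖ ^ 2) ^ β * ‖secondCoeff u φ z‖ / (1 - ‖φ z‖ ^ 2) ^ (α + 1)

lemma testValue_one_neg_one {α β : ℝ} {u φ : ℂ → ℂ} {z : ℂ} (ha : φ z ∈ unitDisk) :
    testValue α β u φ 1 (-1) z = firstQuot α β u φ z * ‖φ z‖ := by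
  have hd := one_sub_norm_sq_pos ha
  rw [testValue, firstQuot, testFnDeriv_self ha, testFnDeriv2_self ha]
  simp only [mul_neg, mul_one, neg_add_cancel, mul_zero, add_zero, norm_mul, Complex.norm_real,
    Complex.norm_conj]
  rw [Real.norm_of_nonneg (by positivity), Real.rpow_neg hd.le]
  ring

lemma testValue_zero_one {α β : ℝ} {u φ : ℂ → ℂ} {z : ℂ} (ha : φ z ∈ unitDisk) :
    testValue α β u φ 0 1 z = 2 * secondQuot α β u φ z * ‖φ z‖ ^ 2 := by
  have hd := one_sub_norm_sq_pos ha
  rw [testValue, secondQuot, testFnDeriv_self ha, testFnDeriv2_self ha]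
  simp only [mul_one, mul_zero, add_zero, zero_add, norm_mul, Complex.norm_real,
    Complex.norm_conj, norm_pow, RCLike.norm_ofNat]
  rw [Real.norm_of_nonneg (by positivity), Real.rpow_neg hd.le]
  ring

lemma firstQuot_nonneg {α β : ℝ} {u φ : ℂ → ℂ} {z : ℂ} (hz : z ∈ unitDisk)
    (ha : φ z ∈ unitDisk) : 0 ≤ firstQuot α β u φ z := by
  have h1 := one_sub_norm_sq_pos hz
  have h2 := one_sub_norm_sq_pos ha
  unfold firstQuot
  positivity

lemma secondQuot_nonneg {α β : ℝ} {u φ : ℂ → ℂ} {z : ℂ} (hz : z ∈ unitDisk)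
    (ha : φ z ∈ unitDisk) : 0 ≤ secondQuot α β u φ z := by
  have h1 := one_sub_norm_sq_pos hz
  have h2 := one_sub_norm_sq_pos ha
  unfold secondQuot
  positivity

lemma div_rpow_le_of_norm_le_half {a : ℂ} (ha : ‖a‖ ≤ 1 / 2) {p q : ℝ} (hq : 0 ≤ q)
    (hp0 : 0 ≤ p) (hp : p ≤ 2) : q / (1 - ‖a‖ ^ 2) ^ p ≤ 2 * q := by
  have h1 : (3 / 4 : ℝ) ≤ 1 - ‖a‖ ^ 2 := by nlinarith [norm_nonneg a]
  have h2 : (1 / 2 : ℝ) ≤ (1 - ‖a‖ ^ 2) ^ p := by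
    calc (1 / 2 : ℝ) ≤ (3 / 4) ^ (2 : ℝ) := by norm_num
      _ ≤ (3 / 4) ^ p := Real.rpow_le_rpow_of_exponent_ge (by norm_num) (by norm_num) hp
      _ ≤ _ := Real.rpow_le_rpow (by norm_num) h1 hp0
  rw [div_le_iff₀ (by linarith)]
  nlinarith

/-- Boundedness of the operator bounds all the coefficients. -/
lemma exists_coeff_bound {α β : ℝ} (hα0 : 0 < α) (hα1 : α < 1) {u φ : ℂ → ℂ}
    (hu : DifferentiableOn ℂ u unitDisk) (hφ : DifferentiableOn ℂ φ unitDisk)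
    (hm : MapsTo φ unitDisk unitDisk) (hb : BoundedBlochToZygmund α β u φ) :
    ∃ D : ℝ, 0 < D ∧ ∀ z ∈ unitDisk,
      (1 - ‖z‖ ^ 2) ^ β * ‖deriv (deriv u) z‖ ≤ D ∧
      (1 - ‖z‖ ^ 2) ^ β * ‖firstCoeff u φ z‖ ≤ D ∧
      (1 - ‖z‖ ^ 2) ^ β * ‖secondCoeff u φ z‖ ≤ D ∧
      firstQuot α β u φ z ≤ D ∧ secondQuot α β u φ z ≤ D := by
  obtain ⟨hmem, C, hC, hbd⟩ := hb
  refine ⟨136 * C, by positivity, fun z hz => ?_⟩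
  have ha := hm hz
  have ha1 := norm_lt_one_of_mem ha
  have hW : 0 ≤ (1 - ‖z‖ ^ 2) ^ β := Real.rpow_nonneg (one_sub_norm_sq_pos hz).le _
  have h1 : (1 - ‖z‖ ^ 2) ^ β * ‖deriv (deriv u) z‖ ≤ C * 1 := by
    obtain ⟨hB, hN⟩ := memBloch_of_norm_deriv_le hα0.le (f := fun _ => (1 : ℂ)) (M := 0)
      (differentiableOn_const 1) (by simp)
    have h := weighted_second_deriv_le hu hφ hm hB.1 (hmem _ hB) hz
    simp only [deriv_const', mul_zero, add_zero, mul_one, norm_one] at h hN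
    exact h.trans ((hbd _ hB).trans (by gcongr))
  have h2 : (1 - ‖z‖ ^ 2) ^ β * ‖firstCoeff u φ z‖ ≤ C * 2 := by
    have hd : deriv (fun w : ℂ => w - φ z) = fun _ => 1 := by
      funext w
      simp
    obtain ⟨hB, hN⟩ := memBloch_of_norm_deriv_le hα0.le (f := fun w => w - φ z) (M := 1)
      (by fun_prop) (by simp)
    have h := weighted_second_deriv_le hu hφ hm hB.1 (hmem _ hB) hz
    simp only [hd, deriv_const', mul_zero, add_zero, mul_one, sub_self, zero_add] at h
    have hN' : blochNorm α (fun w => w - φ z) ≤ 2 := by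
      simp only [zero_sub, norm_neg] at hN
      linarith
    exact h.trans ((hbd _ hB).trans (by gcongr))
  have h3 : (1 - ‖z‖ ^ 2) ^ β * ‖secondCoeff u φ z‖ ≤ C * 5 := by
    have hd : deriv (fun w : ℂ => (w - φ z) ^ 2) = fun w => 2 * (w - φ z) :=
      funext fun w => (hasDerivAt_sub_const_sq (φ z) w).deriv
    have hd2 : deriv (fun w : ℂ => 2 * (w - φ z)) = fun _ => 2 := by
      funext w
      simp
    obtain ⟨hB, hN⟩ := memBloch_of_norm_deriv_le hα0.le (f := fun w => (w - φ z) ^ 2) (M := 4)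
      (by fun_prop) (by
        intro w hw
        rw [hd, norm_mul, RCLike.norm_ofNat]
        have := norm_sub_le w (φ z)
        linarith [norm_lt_one_of_mem hw])
    have h := weighted_second_deriv_le hu hφ hm hB.1 (hmem _ hB) hz
    simp only [hd, hd2, mul_zero, sub_self, zero_add, norm_mul, RCLike.norm_ofNat, ne_eq,
      OfNat.ofNat_ne_zero, not_false_eq_true, zero_pow] at h
    have hN' : blochNorm α (fun w => (w - φ z) ^ 2) ≤ 5 := by
      simp only [zero_sub, even_two, Even.neg_pow, norm_pow] at hN
      nlinarith [norm_nonneg (φ z)]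
    have h' := h.trans ((hbd _ hB).trans (mul_le_mul_of_nonneg_left hN' hC.le))
    nlinarith [mul_nonneg hW (norm_nonneg (secondCoeff u φ z))]
  have htest : ∀ x y : ℂ, ‖x‖ ≤ 1 → ‖y‖ ≤ 1 → testValue α β u φ x y z ≤ C * 68 := by
    intro x y hx hy
    obtain ⟨hB, hN⟩ := memBloch_testFn hα0 hα1 ha hx hy
    exact (testValue_le hu hφ hm hz (hmem _ hB)).trans ((hbd _ hB).trans (by gcongr))
  have h4 := htest 1 (-1) (by simp) (by simp)
  have h5 := htest 0 1 (by simp) (by simp)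
  rw [testValue_one_neg_one ha] at h4
  rw [testValue_zero_one ha] at h5
  have hq1 := firstQuot_nonneg (α := α) (β := β) (u := u) hz ha
  have hq2 := secondQuot_nonneg (α := α) (β := β) (u := u) hz ha
  refine ⟨by linarith, by linarith, by linarith, ?_, ?_⟩
  · rcases le_total ‖φ z‖ (1 / 2) with h | h
    · have := div_rpow_le_of_norm_le_half h (mul_nonneg hW (norm_nonneg (firstCoeff u φ z)))
        hα0.le (by linarith)
      unfold firstQuot
      linarith
    · nlinarith
  · rcases le_total ‖φ z‖ (1 / 2) with h | h
    · have := div_rpow_le_of_norm_le_half h (mul_nonneg hW (norm_nonneg (secondCoeff u φ z)))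
        (p := α + 1) (by linarith) (by linarith)
      unfold secondQuot
      linarith
    · nlinarith [mul_le_mul h h (by norm_num) (norm_nonneg _)]

lemma IsCompactOpToZygmund.map_sub {α β : ℝ} {K : (ℂ → ℂ) → ℂ → ℂ}
    (hK : IsCompactOpToZygmund α β (MemBloch α) K) {f g : ℂ → ℂ} (hf : MemBloch α f)
    (hg : MemBloch α g) : K (fun z => f z - g z) = fun z => K f z - K g z := by
  simpa [← sub_eq_add_neg] using hK.1 f g hf hg 1 (-1)

lemma IsCompactOpToZygmund.map_const_mul {α β : ℝ} {K : (ℂ → ℂ) → ℂ → ℂ}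
    (hK : IsCompactOpToZygmund α β (MemBloch α) K) {f : ℂ → ℂ} (hf : MemBloch α f) (a : ℂ) :
    K (fun z => a * f z) = fun z => a * K f z := by
  simpa using hK.1 f f hf hf a 0

lemma MemZygmund.const_mul {β : ℝ} {f : ℂ → ℂ} (hf : MemZygmund β f) (a : ℂ) :
    MemZygmund β (fun z => a * f z) ∧
      zygNorm β (fun z => a * f z) ≤ ‖a‖ * zygNorm β f := by
  simpa using hf.combo hf a 0

/-- An operator bound on the unit ball extends by homogeneity. -/
lemma zygNorm_le_of_unit_ball {α β ρ R : ℝ} (hR : 0 < R) {L : (ℂ → ℂ) → ℂ → ℂ}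
    (hL : ∀ f, MemBloch α f → ∀ a : ℂ, L (fun z => a * f z) = fun z => a * L f z)
    (hmem : ∀ f, MemBloch α f → MemZygmund β (L f))
    (hρ : ∀ f, MemBloch α f → blochNorm α f ≤ 1 → zygNorm β (L f) ≤ ρ) {f : ℂ → ℂ}
    (hf : MemBloch α f) (hfR : blochNorm α f ≤ R) : zygNorm β (L f) ≤ R * ρ := by
  obtain ⟨h1, h2⟩ := hf.const_mul ((R : ℂ)⁻¹)
  rw [norm_inv, Complex.norm_real, Real.norm_of_nonneg hR.le] at h2
  have h3 : blochNorm α (fun z => (R : ℂ)⁻¹ * f z) ≤ 1 := by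
    refine h2.trans ?_
    rw [inv_mul_le_iff₀ hR, mul_one]
    exact hfR
  have h4 := ((hmem _ h1).const_mul (R : ℂ)).2
  have hR' : (R : ℂ) ≠ 0 := by exact_mod_cast hR.ne'
  have h5 : (fun z => (R : ℂ) * L (fun z => (R : ℂ)⁻¹ * f z) z) = L f := by
    funext z
    rw [hL f hf]
    field_simp
  rw [h5, Complex.norm_real, Real.norm_of_nonneg hR.le] at h4
  exact h4.trans (mul_le_mul_of_nonneg_left (hρ _ h1 h3) hR.le)

/-- A compact operator sends infinitely many terms of a bounded sequence close together. -/
lemma IsCompactOpToZygmund.exists_infinite_close {α β : ℝ} {K : (ℂ → ℂ) → ℂ → ℂ}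
    (hK : IsCompactOpToZygmund α β (MemBloch α) K) {R : ℝ} (hR : 0 < R) {f : ℕ → ℂ → ℂ}
    (hf : ∀ n, MemBloch α (f n)) (hfR : ∀ n, blochNorm α (f n) ≤ R) {ε : ℝ} (hε : 0 < ε) :
    ∃ S : Set ℕ, S.Infinite ∧ ∀ n ∈ S, ∀ m ∈ S,
      zygNorm β (K fun z => f n z - f m z) ≤ ε := by
  obtain ⟨T, hT, hcov⟩ := hK.2.2.2 (ε / (2 * R)) (by positivity)
  have hF : ∀ n, MemBloch α (fun z => (R : ℂ)⁻¹ * f n z) ∧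
      blochNorm α (fun z => (R : ℂ)⁻¹ * f n z) ≤ 1 := by
    intro n
    obtain ⟨h1, h2⟩ := (hf n).const_mul ((R : ℂ)⁻¹)
    rw [norm_inv, Complex.norm_real, Real.norm_of_nonneg hR.le] at h2
    refine ⟨h1, h2.trans ?_⟩
    rw [inv_mul_le_iff₀ hR, mul_one]
    exact hfR n
  choose g hgT hg using fun n => hcov _ (hF n).1 (hF n).2
  obtain ⟨y, hy⟩ := Finite.exists_infinite_fiber (fun n => (⟨g n, hgT n⟩ : T))
  refine ⟨_, Set.infinite_coe_iff.1 hy, fun n hn m hm => ?_⟩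
  have hgn : g n = y := congrArg Subtype.val (show (⟨g n, hgT n⟩ : T) = y from hn)
  have hgm : g m = y := congrArg Subtype.val (show (⟨g m, hgT m⟩ : T) = y from hm)
  have hKn := hK.2.1 _ (hF n).1
  have hKm := hK.2.1 _ (hF m).1
  have hyZ := hT y y.2
  have e1 := hg n
  have e2 := hg m
  rw [hgn] at e1
  rw [hgm] at e2
  obtain ⟨m1, b1⟩ := (hKn.sub hyZ).1.sub (hKm.sub hyZ).1
  have b2 := (m1.const_mul (R : ℂ)).2
  have hR' : (R : ℂ) ≠ 0 := by exact_mod_cast hR.ne'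
  have h5 : (K fun z => f n z - f m z) = fun z => (R : ℂ) *
      (K (fun z => (R : ℂ)⁻¹ * f n z) z - (y : ℂ → ℂ) z -
        (K (fun z => (R : ℂ)⁻¹ * f m z) z - (y : ℂ → ℂ) z)) := by
    rw [hK.map_sub (hf n) (hf m), hK.map_const_mul (hf n), hK.map_const_mul (hf m)]
    funext z
    field_simp
    ring
  rw [h5]
  rw [Complex.norm_real, Real.norm_of_nonneg hR.le] at b2
  calc _ ≤ R * (ε / (2 * R) + ε / (2 * R)) :=
        b2.trans (mul_le_mul_of_nonneg_left (b1.trans (add_le_add e1 e2)) hR.le)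
    _ = ε := by
        field_simp
        norm_num

lemma tendsto_rpow_zero {d : ℕ → ℝ} (hd : Tendsto d atTop (nhds 0)) {p : ℝ} (hp : 0 < p) :
    Tendsto (fun n => d n ^ p) atTop (nhds 0) := by
  simpa [Real.zero_rpow hp.ne'] using hd.rpow_const (Or.inr hp.le)

lemma le_of_testValue_large {α β : ℝ} (hα0 : 0 < α) (hα1 : α < 1) {u φ : ℂ → ℂ}
    (hu : DifferentiableOn ℂ u unitDisk) (hφ : DifferentiableOn ℂ φ unitDisk)
    (hm : MapsTo φ unitDisk unitDisk) (hb : BoundedBlochToZygmund α β u φ)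
    {K : (ℂ → ℂ) → ℂ → ℂ} (hK : IsCompactOpToZygmund α β (MemBloch α) K) {ρ : ℝ}
    (hρ : ∀ f, MemBloch α f → blochNorm α f ≤ 1 →
      zygNorm β (fun z => wcomp u φ f z - K f z) ≤ ρ) {x y : ℂ} (hx : ‖x‖ ≤ 1) (hy : ‖y‖ ≤ 1)
    {v : ℝ} (hv : ∀ s < 1, ∃ z ∈ unitDisk, s < ‖φ z‖ ∧ v ≤ testValue α β u φ x y z) :
    v ≤ 136 * ρ := by
  obtain ⟨D, hD, hbound⟩ := exists_coeff_bound hα0 hα1 hu hφ hm hb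
  have hseq : ∀ n : ℕ, ∃ z ∈ unitDisk, 1 - 1 / ((n : ℝ) + 1) < ‖φ z‖ ∧
      v ≤ testValue α β u φ x y z := fun n =>
    hv _ (by have : 0 < 1 / ((n : ℝ) + 1) := by positivity
             linarith)
  choose z hz hsz hvz using hseq
  have ha : ∀ n, φ (z n) ∈ unitDisk := fun n => hm (hz n)
  set d : ℕ → ℝ := fun n => 1 - ‖φ (z n)‖ ^ 2 with hd_def
  have hd0 : ∀ n, 0 < d n := fun n => one_sub_norm_sq_pos (ha n)
  have hdlim : Tendsto d atTop (nhds 0) := by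
    have h1 : Tendsto (fun n : ℕ => 2 * (1 / ((n : ℝ) + 1))) atTop (nhds 0) := by
      simpa using tendsto_one_div_add_atTop_nhds_zero_nat.const_mul (2 : ℝ)
    refine squeeze_zero (fun n => (hd0 n).le) (fun n => ?_) h1
    have h2 := hsz n
    have h3 := norm_lt_one_of_mem (ha n)
    simp only [hd_def]
    nlinarith [norm_nonneg (φ (z n))]
  have hB := fun n => memBloch_testFn (x := x) (y := y) hα0 hα1 (ha n) hx hy
  have hLmem : ∀ f, MemBloch α f → MemZygmund β (fun z => wcomp u φ f z - K f z) :=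
    fun f hf => ((hb.1 f hf).sub (hK.2.1 f hf)).1
  have hstep : ∀ {ε : ℝ}, 0 < ε → v ≤ 136 * ρ + ε * 4 := by
    intro ε hε
    obtain ⟨S, hS, hclose⟩ := hK.exists_infinite_close (by norm_num : (0 : ℝ) < 68)
      (fun n => (hB n).1) (fun n => (hB n).2) hε
    have hfreq := Nat.frequently_atTop_iff_infinite.2 hS
    have hev1 : ∀ᶠ m in atTop, D * 12 * d m ^ (1 - α) < ε := by
      have := (tendsto_rpow_zero hdlim (sub_pos.2 hα1)).const_mul (D * 12)
      rw [mul_zero] at this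
      exact this.eventually_lt_const hε
    obtain ⟨m, hmS, hm1⟩ := (hfreq.and_eventually hev1).exists
    have hev2 : ∀ᶠ n in atTop, D * 28 * d m ^ (-α) * d n ^ α < ε := by
      have := (tendsto_rpow_zero hdlim hα0).const_mul (D * 28 * d m ^ (-α))
      rw [mul_zero] at this
      exact this.eventually_lt_const hε
    have hev3 : ∀ᶠ n in atTop, D * 144 * d m ^ (-(α + 1)) * d n ^ (α + 1) < ε := by
      have := (tendsto_rpow_zero hdlim (by linarith : 0 < α + 1)).const_mul
        (D * 144 * d m ^ (-(α + 1)))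
      rw [mul_zero] at this
      exact this.eventually_lt_const hε
    obtain ⟨n, hnS, hn2, hn3⟩ := (hfreq.and_eventually (hev2.and hev3)).exists
    obtain ⟨hh, hhN⟩ := (hB n).1.sub (hB m).1
    set h : ℂ → ℂ := fun w => testFn α (φ (z n)) x y w - testFn α (φ (z m)) x y w with hh_def
    have hKh : zygNorm β (K h) ≤ ε := hclose n hnS m hmS
    have hLh : zygNorm β (fun z => wcomp u φ h z - K h z) ≤ 136 * ρ := by
      refine zygNorm_le_of_unit_ball (L := fun f z => wcomp u φ f z - K f z) (by norm_num)
        (fun f hf a => ?_) hLmem hρ hh (by linarith [(hB n).2, (hB m).2])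
      funext w
      rw [hK.map_const_mul hf]
      simp only [wcomp]
      ring
    have hw : zygNorm β (wcomp u φ h) ≤ 136 * ρ + ε := by
      have := ((hLmem h hh).add (hK.2.1 h hh)).2
      simp only [sub_add_cancel] at this
      linarith
    have hmain := (weighted_second_deriv_le hu hφ hm hh.1 (hb.1 h hh) (hz n)).trans hw
    have hsub : h = fun w => 1 * testFn α (φ (z n)) x y w + (-1) * testFn α (φ (z m)) x y w := by
      funext w
      simp only [hh_def]
      ring
    have hd1 := deriv_combo (hB n).1.1 (hB m).1.1 1 (-1) (ha n)
    have hd2 := deriv2_combo (hB n).1.1 (hB m).1.1 1 (-1) (ha n)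
    rw [← hsub] at hd1 hd2
    rw [hd1, hd2] at hmain
    simp only [hh_def, deriv_testFn (ha n) x y (ha n), deriv2_testFn (ha n) x y (ha n),
      deriv_testFn (ha m) x y (ha n), deriv2_testFn (ha m) x y (ha n), testFn_self (ha n)] at hmain
    obtain ⟨hu2, -, -, hq1, hq2⟩ := hbound (z n) (hz n)
    have hWn : 0 ≤ (1 - ‖z n‖ ^ 2) ^ β := Real.rpow_nonneg (one_sub_norm_sq_pos (hz n)).le _
    set W := (1 - ‖z n‖ ^ 2) ^ β with hW_def
    have e0 := norm_testFn_le (α := α) (ha m) (ha n) hx hy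
    have e1 := norm_testFnDeriv_le (α := α) (ha m) (ha n) hx hy
    have e2 := norm_testFnDeriv2_le (α := α) (ha m) (ha n) hx hy
    have hdn := hd0 n
    have hdm := hd0 m
    have hA : W * ‖firstCoeff u φ (z n)‖ ≤ D * d n ^ α := by
      rwa [firstQuot, div_le_iff₀ (Real.rpow_pos_of_pos hdn _)] at hq1
    have hB' : W * ‖secondCoeff u φ (z n)‖ ≤ D * d n ^ (α + 1) := by
      rwa [secondQuot, div_le_iff₀ (Real.rpow_pos_of_pos hdn _)] at hq2
    have hV := hvz n
    rw [testValue] at hV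
    set A := firstCoeff u φ (z n)
    set B := secondCoeff u φ (z n)
    set U := deriv (deriv u) (z n)
    set p0 := testFn α (φ (z m)) x y (φ (z n))
    set p1 := testFnDeriv α (φ (z m)) x y (φ (z n))
    set p2 := testFnDeriv2 α (φ (z m)) x y (φ (z n))
    set q1 := testFnDeriv α (φ (z n)) x y (φ (z n))
    set q2 := testFnDeriv2 α (φ (z n)) x y (φ (z n))
    have htri : ‖A * q1 + B * q2‖ ≤ ‖U * (0 - p0) + (A * (1 * q1 + -1 * p1) +
        B * (1 * q2 + -1 * p2))‖ + (‖U‖ * ‖p0‖ + ‖A‖ * ‖p1‖ + ‖B‖ * ‖p2‖) := by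
      have h1 : A * q1 + B * q2 = (U * (0 - p0) + (A * (1 * q1 + -1 * p1) +
        B * (1 * q2 + -1 * p2))) + (U * p0 + A * p1 + B * p2) := by ring
      rw [h1]
      refine (norm_add_le _ _).trans ?_
      gcongr
      simpa only [norm_mul] using norm_add₃_le (a := U * p0) (b := A * p1) (c := B * p2)
    have t0 : W * ‖U‖ * ‖p0‖ ≤ D * (12 * d m ^ (1 - α)) := by gcongr
    have t1 : W * ‖A‖ * ‖p1‖ ≤ D * d n ^ α * (28 * d m ^ (-α)) := by gcongr
    have t2 : W * ‖B‖ * ‖p2‖ ≤ D * d n ^ (α + 1) * (144 * d m ^ (-(α + 1))) := by gcongr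
    have t3 := mul_le_mul_of_nonneg_left htri hWn
    nlinarith
  refine le_of_forall_pos_le_add fun ε hε => ?_
  have := hstep (by positivity : 0 < ε / 4)
  linarith

lemma MemBloch.sum {α : ℝ} (hα : 0 ≤ α) {ι : Type*} (s : Finset ι) {e : ι → ℂ → ℂ}
    (he : ∀ i, MemBloch α (e i)) (v : ι → ℂ) :
    MemBloch α (fun z => ∑ i ∈ s, v i * e i z) ∧
      blochNorm α (fun z => ∑ i ∈ s, v i * e i z) ≤ ∑ i ∈ s, ‖v i‖ * blochNorm α (e i) := by
  classical
  induction s using Finset.induction_on with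
  | empty =>
    simpa using memBloch_of_norm_deriv_le hα (f := fun _ => (0 : ℂ)) (M := 0)
      (differentiableOn_const 0) (by simp)
  | insert i s hi ih =>
    simp only [Finset.sum_insert hi]
    have h := (he i).combo ih.1 (v i) 1
    simp only [one_mul, norm_one] at h
    exact ⟨h.1, h.2.trans (by linarith [ih.2])⟩

/-- Finite rank operators, composed with a bounded weighted composition operator, are compact. -/
lemma isCompactOpToZygmund_finiteRank {α β : ℝ} (hα : 0 ≤ α) {u φ : ℂ → ℂ}
    (hb : BoundedBlochToZygmund α β u φ) {ι : Type*} [Fintype ι] {e : ι → ℂ → ℂ}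
    (he : ∀ i, MemBloch α (e i)) {c : ι → (ℂ → ℂ) → ℂ}
    (hc : ∀ i f g, MemBloch α f → MemBloch α g → ∀ a b : ℂ,
      c i (fun z => a * f z + b * g z) = a * c i f + b * c i g)
    {B : ℝ} (hB : 0 ≤ B) (hcB : ∀ i f, MemBloch α f → ‖c i f‖ ≤ B * blochNorm α f) :
    IsCompactOpToZygmund α β (MemBloch α)
      (fun f => wcomp u φ (fun z => ∑ i, c i f * e i z)) := by
  classical
  obtain ⟨hmem, C, hC, hbd⟩ := hb
  have hsum := fun v : ι → ℂ => MemBloch.sum hα Finset.univ he v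
  set E := ∑ i, blochNorm α (e i) with hE
  have hE0 : 0 ≤ E := Finset.sum_nonneg fun i _ => blochNorm_nonneg _ _
  have hnorm : ∀ v : ι → ℂ, blochNorm α (fun z => ∑ i, v i * e i z) ≤ ‖v‖ * E := by
    intro v
    refine (hsum v).2.trans ?_
    rw [hE, Finset.mul_sum]
    exact Finset.sum_le_sum fun i _ =>
      mul_le_mul_of_nonneg_right (norm_le_pi_norm v i) (blochNorm_nonneg _ _)
  have hcN : ∀ f, MemBloch α f → ‖fun i => c i f‖ ≤ B * blochNorm α f := fun f hf =>
    (pi_norm_le_iff_of_nonneg (mul_nonneg hB (blochNorm_nonneg _ _))).2 fun i => hcB i f hf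
  refine ⟨fun f g hf hg a b => ?_, fun f _ => hmem _ (hsum fun i => c i f).1,
    ⟨C * (B * E), fun f hf => ?_⟩, fun ε hε => ?_⟩
  · funext z
    simp only [wcomp, hc _ f g hf hg, Finset.mul_sum, ← Finset.sum_add_distrib]
    exact Finset.sum_congr rfl fun i _ => by ring
  · have h1 := hnorm fun i => c i f
    have h2 := mul_le_mul_of_nonneg_right (hcN f hf) hE0
    calc _ ≤ C * blochNorm α (fun z => ∑ i, c i f * e i z) := hbd _ (hsum fun i => c i f).1
      _ ≤ C * (B * blochNorm α f * E) := by gcongr; exact h1.trans h2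
      _ = _ := by ring
  · have hδ : 0 < ε / (C * (E + 1)) := by positivity
    obtain ⟨t, -, htf, ht⟩ := (isCompact_closedBall (0 : ι → ℂ) B).finite_cover_balls hδ
    refine ⟨htf.toFinset.image fun v => wcomp u φ (fun z => ∑ i, v i * e i z), ?_, ?_⟩
    · intro g hg
      obtain ⟨v, -, rfl⟩ := Finset.mem_image.1 hg
      exact hmem _ (hsum v).1
    · intro f hf hf1
      have h1 : (fun i => c i f) ∈ Metric.closedBall (0 : ι → ℂ) B := by
        rw [mem_closedBall_zero_iff]
        exact (hcN f hf).trans (mul_le_of_le_one_right hB hf1)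
      obtain ⟨v, hv, hfv⟩ := Set.mem_iUnion₂.1 (ht h1)
      refine ⟨_, Finset.mem_image_of_mem _ (htf.mem_toFinset.2 hv), ?_⟩
      have h2 : ‖(fun i => c i f) - v‖ < ε / (C * (E + 1)) := by
        rwa [Metric.mem_ball, dist_eq_norm] at hfv
      have h3 : (fun z => wcomp u φ (fun z => ∑ i, c i f * e i z) z -
          wcomp u φ (fun z => ∑ i, v i * e i z) z) =
          wcomp u φ (fun z => ∑ i, ((fun i => c i f) - v) i * e i z) := by
        rw [← wcomp_sub]
        simp only [← Finset.sum_sub_distrib, Pi.sub_apply, sub_mul]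
      rw [h3]
      calc _ ≤ C * (‖(fun i => c i f) - v‖ * E) :=
            (hbd _ (hsum _).1).trans (mul_le_mul_of_nonneg_left (hnorm _) hC.le)
        _ ≤ C * (ε / (C * (E + 1)) * (E + 1)) := by gcongr; linarith
        _ = ε := by field_simp

/-- The Taylor coefficients at the origin. -/
def taylorCoeff (n : ℕ) (f : ℂ → ℂ) : ℂ := (n.factorial : ℂ)⁻¹ * iteratedDeriv n f 0

lemma taylorCoeff_combo {f g : ℂ → ℂ} (hf : DifferentiableOn ℂ f unitDisk)
    (hg : DifferentiableOn ℂ g unitDisk) (n : ℕ) (a b : ℂ) :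
    taylorCoeff n (fun z => a * f z + b * g z) = a * taylorCoeff n f + b * taylorCoeff n g := by
  have h0 := isOpen_unitDisk.mem_nhds zero_mem_unitDisk
  have hf' : ContDiffAt ℂ n f 0 := (hf.analyticAt h0).contDiffAt
  have hg' : ContDiffAt ℂ n g 0 := (hg.analyticAt h0).contDiffAt
  rw [taylorCoeff, iteratedDeriv_fun_add (contDiffAt_const.mul hf') (contDiffAt_const.mul hg'),
    iteratedDeriv_const_mul_field, iteratedDeriv_const_mul_field, taylorCoeff, taylorCoeff]
  ring

lemma norm_taylorCoeff_le {f : ℂ → ℂ} (hf : DifferentiableOn ℂ f unitDisk) {M : ℝ}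
    (hM : ∀ z ∈ unitDisk, ‖f z‖ ≤ M) {R : ℝ} (hR0 : 0 < R) (hR1 : R < 1) (n : ℕ) :
    ‖taylorCoeff n f‖ ≤ M / R ^ n := by
  have hsub : Metric.closedBall (0 : ℂ) R ⊆ unitDisk := Metric.closedBall_subset_ball hR1
  have h := Complex.norm_iteratedDeriv_le_of_forall_mem_sphere_norm_le (F := ℂ) n hR0
    (DifferentiableOn.diffContOnCl
      (hf.mono (Metric.closure_ball_subset_closedBall.trans hsub)))
    (fun z hz => hM z (hsub (Metric.sphere_subset_closedBall hz)))
  have hn : (0 : ℝ) < n.factorial := by exact_mod_cast n.factorial_pos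
  rw [taylorCoeff, norm_mul, norm_inv, RCLike.norm_natCast, inv_mul_le_iff₀ hn]
  exact h.trans_eq (by ring)

lemma norm_taylor_tail_le {f : ℂ → ℂ} (hf : DifferentiableOn ℂ f unitDisk) {M : ℝ}
    (hM : ∀ z ∈ unitDisk, ‖f z‖ ≤ M) {r R : ℝ} (hr : 0 ≤ r) (hrR : r < R) (hR1 : R < 1) {w : ℂ}
    (hw : ‖w‖ ≤ r) (N : ℕ) :
    ‖f w - ∑ n ∈ Finset.range N, taylorCoeff n f * w ^ n‖ ≤
      M * (r / R) ^ N / (1 - r / R) := by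
  have hR0 : 0 < R := hr.trans_lt hrR
  have hM0 : 0 ≤ M := (norm_nonneg _).trans (hM 0 zero_mem_unitDisk)
  have hsum : HasSum (fun n => taylorCoeff n f * w ^ n) (f w) := by
    have := Complex.hasSum_taylorSeries_on_ball hf
      (show w ∈ Metric.ball (0 : ℂ) 1 from mem_unitDisk_of_norm_lt (by linarith))
    refine this.congr_fun ?_
    intro n
    simp only [taylorCoeff, smul_eq_mul, sub_zero]
    ring
  rw [norm_sub_rev]
  refine norm_sub_le_of_geometric_bound_of_hasSum ((div_lt_one hR0).2 hrR) (fun n => ?_) hsum N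
  rw [norm_mul, norm_pow]
  calc _ ≤ M / R ^ n * r ^ n := by
        gcongr
        exact norm_taylorCoeff_le hf hM hR0 hR1 n
    _ = _ := by rw [div_pow]; ring

lemma mul_mem_unitDisk {r : ℝ} (hr0 : 0 ≤ r) (hr1 : r ≤ 1) {z : ℂ} (hz : z ∈ unitDisk) :
    (r : ℂ) * z ∈ unitDisk := by
  apply mem_unitDisk_of_norm_lt
  rw [norm_mul, Complex.norm_real, Real.norm_of_nonneg hr0]
  nlinarith [norm_nonneg z, norm_lt_one_of_mem hz]

lemma differentiableOn_dilate {f : ℂ → ℂ} (hf : DifferentiableOn ℂ f unitDisk) {r : ℝ}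
    (hr0 : 0 ≤ r) (hr1 : r ≤ 1) : DifferentiableOn ℂ (fun z => f (r * z)) unitDisk :=
  hf.comp (by fun_prop) fun _ hz => mul_mem_unitDisk hr0 hr1 hz

lemma deriv_dilate {f : ℂ → ℂ} (hf : DifferentiableOn ℂ f unitDisk) {r : ℝ}
    (hr0 : 0 ≤ r) (hr1 : r ≤ 1) {z : ℂ} (hz : z ∈ unitDisk) :
    deriv (fun z => f (r * z)) z = deriv f (r * z) * r := by
  have h0 : HasDerivAt (fun s : ℂ => (r : ℂ) * s) r z := by
    simpa using (hasDerivAt_id z).const_mul (r : ℂ)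
  exact ((differentiableAt_of_mem hf (mul_mem_unitDisk hr0 hr1 hz)).hasDerivAt.comp z h0).deriv

lemma MemBloch.dilate {α : ℝ} (hα : 0 ≤ α) {f : ℂ → ℂ} (hf : MemBloch α f) {r : ℝ}
    (hr0 : 0 ≤ r) (hr1 : r ≤ 1) :
    MemBloch α (fun z => f (r * z)) ∧ blochNorm α (fun z => f (r * z)) ≤ blochNorm α f := by
  have key : ∀ z ∈ unitDisk, (1 - ‖z‖ ^ 2) ^ α * ‖deriv (fun z => f (r * z)) z‖ ≤
      wnorm α (deriv f) := by
    intro z hz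
    refine le_trans ?_ (le_wnorm hf.2 (mul_mem_unitDisk hr0 hr1 hz))
    have hz0 := one_sub_norm_sq_pos hz
    rw [deriv_dilate hf.1 hr0 hr1 hz, norm_mul, norm_mul, Complex.norm_real,
      Real.norm_of_nonneg hr0]
    have h1 : r * ‖z‖ ≤ ‖z‖ := mul_le_of_le_one_left (norm_nonneg _) hr1
    gcongr
    · have h2 : (r * ‖z‖) ^ 2 ≤ ‖z‖ ^ 2 := by gcongr
      exact Real.rpow_nonneg (by linarith) α
    · exact mul_le_of_le_one_right (norm_nonneg _) hr1
  refine ⟨⟨differentiableOn_dilate hf.1 hr0 hr1, bddAbove_weighted key⟩, ?_⟩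
  have := wnorm_le key
  simp only [blochNorm, mul_zero]
  linarith

/-- Dilates are uniformly approximated in the Bloch norm by Taylor polynomials. -/
lemma exists_taylor_approx {α : ℝ} (hα0 : 0 < α) (hα1 : α < 1) {r : ℝ} (hr0 : 0 < r)
    (hr1 : r < 1) {η : ℝ} (hη : 0 < η) :
    ∃ N : ℕ, ∀ f, MemBloch α f → blochNorm α f ≤ 1 →
      MemBloch α (fun z => f (r * (r * z)) -
        ∑ n ∈ Finset.range N, taylorCoeff n f * (r * (r * z)) ^ n) ∧
      blochNorm α (fun z => f (r * (r * z)) -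
        ∑ n ∈ Finset.range N, taylorCoeff n f * (r * (r * z)) ^ n) ≤ η := by
  set R := (1 + r) / 2 with hR
  set M := 1 + 1 / (1 - α) with hMdef
  have hα : 0 < 1 - α := by linarith
  have hM0 : 0 < M := by positivity
  have hrR : r < R := by rw [hR]; linarith
  have hR1 : R < 1 := by rw [hR]; linarith
  have hR0 : 0 < R := hr0.trans hrR
  have hr2 : 0 < 1 - r ^ 2 := by nlinarith
  set δ := η * (1 - r ^ 2) / 5 with hδ
  have hδ0 : 0 < δ := by positivity
  have hlim : Tendsto (fun N : ℕ => M * (r / R) ^ N / (1 - r / R)) atTop (nhds 0) := by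
    simpa using ((tendsto_pow_atTop_nhds_zero_of_lt_one (by positivity)
      ((div_lt_one hR0).2 hrR)).const_mul M).div_const (1 - r / R)
  obtain ⟨N, hN⟩ := (hlim.eventually_lt_const hδ0).exists
  refine ⟨N, fun f hf hf1 => ?_⟩
  have hfM : ∀ z ∈ unitDisk, ‖f z‖ ≤ M := fun z hz =>
    (hf.norm_le hα0 hα1 hz).trans (mul_le_of_le_one_right hM0.le hf1)
  set H : ℂ → ℂ := fun w => f w - ∑ n ∈ Finset.range N, taylorCoeff n f * w ^ n with hH
  have hHd : DifferentiableOn ℂ H unitDisk := hf.1.sub (by fun_prop)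
  have hGd := differentiableOn_dilate hHd hr0.le hr1.le
  have hG : ∀ z ∈ unitDisk, ‖H (r * z)‖ ≤ δ := by
    intro z hz
    refine (norm_taylor_tail_le hf.1 hfM hr0.le hrR hR1 ?_ N).trans hN.le
    rw [norm_mul, Complex.norm_real, Real.norm_of_nonneg hr0.le]
    exact mul_le_of_le_one_right hr0.le (norm_lt_one_of_mem hz).le
  have hderiv : ∀ z ∈ unitDisk, ‖deriv (fun z => H (r * (r * z))) z‖ ≤ 4 * δ / (1 - r ^ 2) := by
    intro z hz
    have hz' := mul_mem_unitDisk hr0.le hr1.le hz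
    have h1 := weighted_deriv_le_of_weighted_le le_rfl hGd
      (fun z hz => by simpa using hG z hz) hz'
    simp only [zero_add, Real.rpow_one] at h1
    have h2 : ‖(r : ℂ) * z‖ ≤ r := by
      rw [norm_mul, Complex.norm_real, Real.norm_of_nonneg hr0.le]
      exact mul_le_of_le_one_right hr0.le (norm_lt_one_of_mem hz).le
    rw [deriv_dilate hGd hr0.le hr1.le hz, norm_mul, Complex.norm_real,
      Real.norm_of_nonneg hr0.le, le_div_iff₀ hr2]
    calc _ ≤ ‖deriv (fun z => H (r * z)) (r * z)‖ * 1 * (1 - ‖(r : ℂ) * z‖ ^ 2) := by gcongr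
      _ = (1 - ‖(r : ℂ) * z‖ ^ 2) * ‖deriv (fun z => H (r * z)) (r * z)‖ := by ring
      _ ≤ 4 * δ := h1
  obtain ⟨h1, h2⟩ := memBloch_of_norm_deriv_le hα0.le
    (differentiableOn_dilate hGd hr0.le hr1.le) hderiv
  refine ⟨h1, h2.trans ?_⟩
  have h3 := hG 0 zero_mem_unitDisk
  simp only [mul_zero] at h3 ⊢
  have h4 : δ ≤ δ / (1 - r ^ 2) := by
    rw [le_div_iff₀ hr2]
    nlinarith
  calc _ ≤ δ / (1 - r ^ 2) + 4 * δ / (1 - r ^ 2) := by gcongr; exact h3.trans h4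
    _ = η := by
        rw [hδ]
        field_simp
        norm_num

/-- Estimate of the operator on a uniformly small function of bounded Bloch norm. -/
lemma zygNorm_wcomp_le_of_small {α β : ℝ} (hα0 : 0 < α) {u φ : ℂ → ℂ}
    (hu : DifferentiableOn ℂ u unitDisk) (hφ : DifferentiableOn ℂ φ unitDisk)
    (hm : MapsTo φ unitDisk unitDisk) {D s Q₁ Q₂ : ℝ} (hD : 0 < D) (hs0 : 0 ≤ s) (hs1 : s < 1)
    (hbound : ∀ z ∈ unitDisk,
      (1 - ‖z‖ ^ 2) ^ β * ‖deriv (deriv u) z‖ ≤ D ∧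
      (1 - ‖z‖ ^ 2) ^ β * ‖firstCoeff u φ z‖ ≤ D ∧
      (1 - ‖z‖ ^ 2) ^ β * ‖secondCoeff u φ z‖ ≤ D)
    (hQ₁0 : 0 ≤ Q₁) (hQ₂0 : 0 ≤ Q₂)
    (hQ₁ : ∀ z ∈ unitDisk, s < ‖φ z‖ → firstQuot α β u φ z ≤ Q₁)
    (hQ₂ : ∀ z ∈ unitDisk, s < ‖φ z‖ → secondQuot α β u φ z ≤ Q₂)
    {g : ℂ → ℂ} (hg : MemBloch α g) (hg2 : blochNorm α g ≤ 2) {ε : ℝ}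
    (hε : ∀ z ∈ unitDisk, ‖g z‖ ≤ ε) :
    zygNorm β (wcomp u φ g) ≤ ε * (‖u 0‖ + ‖deriv u 0‖ +
      ‖u 0‖ * ‖deriv φ 0‖ * (4 / (1 - ‖φ 0‖ ^ 2)) +
      (D + D * (4 / (1 - s ^ 2)) + D * (64 / (1 - s ^ 2) ^ 2))) +
      (2 * Q₁ + 2 * 4 ^ (α + 1) * Q₂) := by
  have hε0 : 0 ≤ ε := (norm_nonneg _).trans (hε 0 zero_mem_unitDisk)
  have hs : 0 < 1 - s ^ 2 := by nlinarith
  have hg1 : ∀ w ∈ unitDisk, (1 - ‖w‖ ^ 2) ^ (1 : ℝ) * ‖deriv g w‖ ≤ 4 * ε := by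
    intro w hw
    simpa using weighted_deriv_le_of_weighted_le le_rfl hg.1
      (fun z hz => by simpa using hε z hz) hw
  have hg2' : ∀ w ∈ unitDisk, (1 - ‖w‖ ^ 2) ^ 2 * ‖deriv (deriv g) w‖ ≤ 64 * ε := by
    intro w hw
    have h := weighted_deriv_le_of_weighted_le zero_le_one (differentiableOn_deriv hg.1) hg1 hw
    rw [show (1 : ℝ) + 1 = (2 : ℕ) by norm_num, Real.rpow_natCast, Real.rpow_natCast] at h
    linarith
  simp only [Real.rpow_one] at hg1
  have hgα : ∀ w ∈ unitDisk, (1 - ‖w‖ ^ 2) ^ α * ‖deriv g w‖ ≤ 2 :=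
    fun w hw => (hg.weighted_deriv_le hw).trans hg2
  have hgα2 : ∀ w ∈ unitDisk, (1 - ‖w‖ ^ 2) ^ (α + 1) * ‖deriv (deriv g) w‖ ≤
      4 ^ (α + 1) * 2 := fun w hw =>
    weighted_deriv_le_of_weighted_le hα0.le (differentiableOn_deriv hg.1) hgα hw
  have ha0 := hm zero_mem_unitDisk
  have h0 : ‖wcomp u φ g 0‖ ≤ ‖u 0‖ * ε := by
    rw [wcomp, norm_mul]
    gcongr
    exact hε _ ha0
  have h1 : ‖deriv (wcomp u φ g) 0‖ ≤ ‖deriv u 0‖ * ε +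
      ‖u 0‖ * (4 * ε / (1 - ‖φ 0‖ ^ 2) * ‖deriv φ 0‖) := by
    rw [deriv_wcomp hu hφ hm hg.1 zero_mem_unitDisk]
    refine (norm_add_le _ _).trans ?_
    rw [norm_mul, norm_mul, norm_mul]
    gcongr
    · exact hε _ ha0
    · rw [le_div_iff₀ (one_sub_norm_sq_pos ha0), mul_comm]
      exact hg1 _ ha0
  have h4 : (0 : ℝ) < 4 ^ (α + 1) := by positivity
  have h2 : wnorm β (deriv (deriv (wcomp u φ g))) ≤
      ε * (D + D * (4 / (1 - s ^ 2)) + D * (64 / (1 - s ^ 2) ^ 2)) +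
      (2 * Q₁ + 2 * 4 ^ (α + 1) * Q₂) := by
    refine wnorm_le fun z hz => ?_
    obtain ⟨b0, b1, b2⟩ := hbound z hz
    have ha := hm hz
    have hd := one_sub_norm_sq_pos ha
    have hW : 0 ≤ (1 - ‖z‖ ^ 2) ^ β := Real.rpow_nonneg (one_sub_norm_sq_pos hz).le _
    rw [deriv2_wcomp hu hφ hm hg.1 hz]
    have q1 := hQ₁ z hz
    have q2 := hQ₂ z hz
    rw [firstQuot, div_le_iff₀ (Real.rpow_pos_of_pos hd _)] at q1
    rw [secondQuot, div_le_iff₀ (Real.rpow_pos_of_pos hd _)] at q2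
    set W := (1 - ‖z‖ ^ 2) ^ β
    set A := firstCoeff u φ z
    set B := secondCoeff u φ z
    set U := deriv (deriv u) z
    have t0 : W * ‖U‖ * ‖g (φ z)‖ ≤ D * ε := by
      gcongr
      exact hε _ ha
    have htri : W * ‖U * g (φ z) + (A * deriv g (φ z) + B * deriv (deriv g) (φ z))‖ ≤
        W * ‖U‖ * ‖g (φ z)‖ + W * ‖A‖ * ‖deriv g (φ z)‖ +
          W * ‖B‖ * ‖deriv (deriv g) (φ z)‖ := by
      have := norm_add₃_le (a := U * g (φ z)) (b := A * deriv g (φ z))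
        (c := B * deriv (deriv g) (φ z))
      simp only [norm_mul] at this
      rw [← add_assoc]
      calc _ ≤ W * (‖U‖ * ‖g (φ z)‖ + ‖A‖ * ‖deriv g (φ z)‖ + ‖B‖ * ‖deriv (deriv g) (φ z)‖) := by
            gcongr
        _ = _ := by ring
    rcases le_or_gt ‖φ z‖ s with h | h
    · have hds : 1 - s ^ 2 ≤ 1 - ‖φ z‖ ^ 2 := by gcongr
      have t1 : W * ‖A‖ * ‖deriv g (φ z)‖ ≤ D * (4 * ε / (1 - s ^ 2)) := by
        gcongr
        rw [le_div_iff₀ hs, mul_comm]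
        exact le_trans (by gcongr) (hg1 _ ha)
      have t2 : W * ‖B‖ * ‖deriv (deriv g) (φ z)‖ ≤ D * (64 * ε / (1 - s ^ 2) ^ 2) := by
        gcongr
        rw [le_div_iff₀ (by positivity), mul_comm]
        exact le_trans (by gcongr) (hg2' _ ha)
      have t3 : 0 ≤ 2 * Q₁ + 2 * 4 ^ (α + 1) * Q₂ := by positivity
      calc _ ≤ D * ε + D * (4 * ε / (1 - s ^ 2)) + D * (64 * ε / (1 - s ^ 2) ^ 2) :=
            htri.trans (by gcongr)
        _ = ε * (D + D * (4 / (1 - s ^ 2)) + D * (64 / (1 - s ^ 2) ^ 2)) := by ring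
        _ ≤ _ := le_add_of_nonneg_right t3
    · have t1 : W * ‖A‖ * ‖deriv g (φ z)‖ ≤ Q₁ * 2 := by
        calc _ ≤ Q₁ * (1 - ‖φ z‖ ^ 2) ^ α * ‖deriv g (φ z)‖ :=
              mul_le_mul_of_nonneg_right (q1 h) (norm_nonneg _)
          _ = Q₁ * ((1 - ‖φ z‖ ^ 2) ^ α * ‖deriv g (φ z)‖) := by ring
          _ ≤ Q₁ * 2 := mul_le_mul_of_nonneg_left (hgα _ ha) hQ₁0
      have t2 : W * ‖B‖ * ‖deriv (deriv g) (φ z)‖ ≤ Q₂ * (4 ^ (α + 1) * 2) := by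
        calc _ ≤ Q₂ * (1 - ‖φ z‖ ^ 2) ^ (α + 1) * ‖deriv (deriv g) (φ z)‖ :=
              mul_le_mul_of_nonneg_right (q2 h) (norm_nonneg _)
          _ = Q₂ * ((1 - ‖φ z‖ ^ 2) ^ (α + 1) * ‖deriv (deriv g) (φ z)‖) := by ring
          _ ≤ _ := mul_le_mul_of_nonneg_left (hgα2 _ ha) hQ₂0
      have t3 : 0 ≤ ε * (D * (4 / (1 - s ^ 2)) + D * (64 / (1 - s ^ 2) ^ 2)) := by positivity
      linarith
  rw [zygNorm]
  calc _ ≤ ‖u 0‖ * ε + (‖deriv u 0‖ * ε + ‖u 0‖ * (4 * ε / (1 - ‖φ 0‖ ^ 2) * ‖deriv φ 0‖)) +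
        (ε * (D + D * (4 / (1 - s ^ 2)) + D * (64 / (1 - s ^ 2) ^ 2)) +
      (2 * Q₁ + 2 * 4 ^ (α + 1) * Q₂)) := by gcongr
    _ = _ := by ring

lemma exists_compact_approx {α β : ℝ} (hα0 : 0 < α) (hα1 : α < 1) {u φ : ℂ → ℂ}
    (hu : DifferentiableOn ℂ u unitDisk) (hφ : DifferentiableOn ℂ φ unitDisk)
    (hm : MapsTo φ unitDisk unitDisk) (hb : BoundedBlochToZygmund α β u φ) {s Q₁ Q₂ : ℝ}
    (hs0 : 0 ≤ s) (hs1 : s < 1) (hQ₁0 : 0 ≤ Q₁) (hQ₂0 : 0 ≤ Q₂)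
    (hQ₁ : ∀ z ∈ unitDisk, s < ‖φ z‖ → firstQuot α β u φ z ≤ Q₁)
    (hQ₂ : ∀ z ∈ unitDisk, s < ‖φ z‖ → secondQuot α β u φ z ≤ Q₂) {δ : ℝ} (hδ : 0 < δ) :
    ∃ K, IsCompactOpToZygmund α β (MemBloch α) K ∧ ∀ f, MemBloch α f → blochNorm α f ≤ 1 →
      zygNorm β (fun z => wcomp u φ f z - K f z) ≤
        2 * Q₁ + 2 * 4 ^ (α + 1) * Q₂ + δ := by
  obtain ⟨D, hD, hbound⟩ := exists_coeff_bound hα0 hα1 hu hφ hm hb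
  obtain ⟨hmem, C, hC, hbd⟩ := hb
  set E := ‖u 0‖ + ‖deriv u 0‖ + ‖u 0‖ * ‖deriv φ 0‖ * (4 / (1 - ‖φ 0‖ ^ 2)) +
      (D + D * (4 / (1 - s ^ 2)) + D * (64 / (1 - s ^ 2) ^ 2)) with hE
  have hα : 0 < 1 - α := by linarith
  obtain ⟨r, hr0, hr1, hrE⟩ : ∃ r : ℝ, 0 < r ∧ r < 1 ∧
      1 / (1 - α) * (1 - r * r) ^ (1 - α) * E < δ / 2 := by
    have hc : ContinuousAt (fun r : ℝ => 1 / (1 - α) * (1 - r * r) ^ (1 - α) * E) 1 := by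
      refine ContinuousAt.mul (ContinuousAt.mul continuousAt_const ?_) continuousAt_const
      exact ContinuousAt.rpow_const (by fun_prop) (Or.inr hα.le)
    have hc' : Tendsto (fun r : ℝ => 1 / (1 - α) * (1 - r * r) ^ (1 - α) * E)
        (nhdsWithin 1 (Iio 1)) (nhds 0) := by
      have := hc.tendsto.mono_left (nhdsWithin_le_nhds (s := Iio (1 : ℝ)))
      simpa [Real.zero_rpow hα.ne'] using this
    obtain ⟨r, h1, h2⟩ := ((hc'.eventually_lt_const (half_pos hδ)).and
      (Ioo_mem_nhdsLT (zero_lt_one' ℝ))).exists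
    exact ⟨r, h2.1, h2.2, h1⟩
  obtain ⟨N, hN⟩ := exists_taylor_approx hα0 hα1 hr0 hr1 (η := δ / (2 * C)) (by positivity)
  have hrr0 : 0 ≤ r * r := by positivity
  have hrr1 : r * r ≤ 1 := by nlinarith
  have he : ∀ n : Fin N, MemBloch α (fun z => ((r : ℂ) * (r * z)) ^ (n : ℕ)) := by
    intro n
    refine (MemBloch.dilate hα0.le (MemBloch.dilate hα0.le (f := fun z => z ^ (n : ℕ))
      (memBloch_of_norm_deriv_le hα0.le (M := n) (by fun_prop) ?_).1 hr0.le hr1.le).1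
      hr0.le hr1.le).1
    intro z hz
    have := pow_le_one₀ (n := (n : ℕ) - 1) (norm_nonneg z) (norm_lt_one_of_mem hz).le
    simpa using mul_le_of_le_one_right (Nat.cast_nonneg (n : ℕ)) this
  set M := 1 + 1 / (1 - α) with hM
  have hM0 : 0 < M := by positivity
  have hK := isCompactOpToZygmund_finiteRank (β := β) hα0.le ⟨hmem, C, hC, hbd⟩ he
    (c := fun n => taylorCoeff n)
    (fun n f g hf hg a b => taylorCoeff_combo hf.1 hg.1 n a b) (B := M * 2 ^ N) (by positivity)
    (fun n f hf => by
      refine (norm_taylorCoeff_le hf.1 (fun z hz => hf.norm_le hα0 hα1 hz)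
        (R := 1 / 2) (by norm_num) (by norm_num) n).trans ?_
      have h0 := blochNorm_nonneg α f
      have h1 : (2 : ℝ) ^ (n : ℕ) ≤ 2 ^ N := pow_le_pow_right₀ (by norm_num) n.2.le
      calc _ = M * blochNorm α f * 2 ^ (n : ℕ) := by
            rw [one_div_pow, one_div ((2 : ℝ) ^ (n : ℕ)), div_inv_eq_mul]
        _ ≤ M * blochNorm α f * 2 ^ N := by gcongr
        _ = _ := by ring)
  refine ⟨_, hK, fun f hf hf1 => ?_⟩
  obtain ⟨ht, htN⟩ := hN f hf hf1
  have hdil := MemBloch.dilate hα0.le hf hrr0 hrr1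
  obtain ⟨hg, hg2⟩ := hf.sub hdil.1
  have hsmall : ∀ z ∈ unitDisk, ‖f z - f ((r * r : ℝ) * z)‖ ≤
      1 / (1 - α) * (1 - r * r) ^ (1 - α) := by
    intro z hz
    refine (hf.norm_sub_dilate_le hα0 hα1 hz hrr0 hrr1).trans ?_
    have : 0 ≤ 1 - r * r := by linarith
    gcongr
  have h1 := zygNorm_wcomp_le_of_small (β := β) hα0 hu hφ hm hD hs0 hs1
    (fun z hz => ⟨(hbound z hz).1, (hbound z hz).2.1, (hbound z hz).2.2.1⟩) hQ₁0 hQ₂0 hQ₁ hQ₂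
    hg (by linarith [hdil.2]) hsmall
  rw [← hE] at h1
  have h2 : zygNorm β (wcomp u φ fun z => f (r * (r * z)) -
      ∑ n ∈ Finset.range N, taylorCoeff n f * (r * (r * z)) ^ n) ≤ δ / 2 := by
    refine (hbd _ ht).trans ?_
    calc _ ≤ C * (δ / (2 * C)) := by gcongr
      _ = δ / 2 := by field_simp
  have h3 := ((hmem _ hg).add (hmem _ ht)).2
  have h4 : (fun z => wcomp u φ f z - wcomp u φ (fun z => ∑ n : Fin N,
      taylorCoeff n f * ((r : ℂ) * (r * z)) ^ (n : ℕ)) z) =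
      fun z => wcomp u φ (fun z => f z - f ((r * r : ℝ) * z)) z +
        wcomp u φ (fun z => f (r * (r * z)) -
          ∑ n ∈ Finset.range N, taylorCoeff n f * (r * (r * z)) ^ n) z := by
    funext z
    simp only [wcomp, Finset.sum_range, ofReal_mul, mul_assoc]
    ring
  rw [h4]
  linarith

lemma phiLimsup_nonneg {φ : ℂ → ℂ} {F : ℂ → ℝ} (hF : ∀ z ∈ unitDisk, 0 ≤ F z) :
    0 ≤ phiLimsup φ F := by
  apply Real.sInf_nonneg
  rintro _ ⟨s, -, rfl⟩
  apply Real.sSup_nonneg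
  rintro _ ⟨z, hz, -, rfl⟩
  exact hF z hz

lemma exists_forall_le_phiLimsup_add {φ : ℂ → ℂ} {F : ℂ → ℝ} {D : ℝ}
    (hFD : ∀ z ∈ unitDisk, F z ≤ D) {δ : ℝ} (hδ : 0 < δ) :
    ∃ s, 0 ≤ s ∧ s < 1 ∧ ∀ z ∈ unitDisk, s < ‖φ z‖ → F z ≤ phiLimsup φ F + δ := by
  obtain ⟨_, ⟨s, hs, rfl⟩, hlt⟩ := exists_lt_of_csInf_lt
    (⟨_, 0, ⟨le_rfl, zero_lt_one⟩, rfl⟩ : ((fun s => sSup {y | ∃ z ∈ unitDisk, s < ‖φ z‖ ∧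
      y = F z}) '' Set.Ico (0:ℝ) 1).Nonempty) (lt_add_of_pos_right (phiLimsup φ F) hδ)
  refine ⟨s, hs.1, hs.2, fun z hz hsz => le_trans ?_ hlt.le⟩
  refine le_csSup ⟨D, ?_⟩ ⟨z, hz, hsz, rfl⟩
  rintro _ ⟨w, hw, -, rfl⟩
  exact hFD w hw

lemma exists_ge_of_lt_phiLimsup {φ : ℂ → ℂ} {F : ℂ → ℝ} (hF : ∀ z ∈ unitDisk, 0 ≤ F z) {v : ℝ}
    (hv0 : 0 ≤ v) (hv : v < phiLimsup φ F) {s : ℝ} (hs0 : 0 ≤ s) (hs : s < 1) :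
    ∃ z ∈ unitDisk, s < ‖φ z‖ ∧ v ≤ F z := by
  have h1 : phiLimsup φ F ≤ sSup {y | ∃ z ∈ unitDisk, s < ‖φ z‖ ∧ y = F z} := by
    refine csInf_le ⟨0, ?_⟩ ⟨s, ⟨hs0, hs⟩, rfl⟩
    rintro _ ⟨t, -, rfl⟩
    apply Real.sSup_nonneg
    rintro _ ⟨z, hz, -, rfl⟩
    exact hF z hz
  have hne : {y | ∃ z ∈ unitDisk, s < ‖φ z‖ ∧ y = F z}.Nonempty := by
    by_contra h
    rw [Set.not_nonempty_iff_eq_empty] at h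
    rw [h, Real.sSup_empty] at h1
    linarith
  obtain ⟨_, ⟨z, hz, hsz, rfl⟩, hlt⟩ := exists_lt_of_lt_csSup hne (hv.trans_le h1)
  exact ⟨z, hz, hsz, hlt.le⟩

lemma bddAbove_opNorm_set {α β : ℝ} {u φ : ℂ → ℂ} (hb : BoundedBlochToZygmund α β u φ)
    {K : (ℂ → ℂ) → ℂ → ℂ} (hK : IsCompactOpToZygmund α β (MemBloch α) K) :
    BddAbove {s | ∃ f, MemBloch α f ∧ blochNorm α f ≤ 1 ∧
      s = zygNorm β (fun z => wcomp u φ f z - K f z)} := by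
  obtain ⟨hmem, C, hC, hbd⟩ := hb
  obtain ⟨C', hC'⟩ := hK.2.2.1
  refine ⟨C + |C'|, ?_⟩
  rintro _ ⟨f, hf, hf1, rfl⟩
  have h0 := blochNorm_nonneg α f
  calc _ ≤ zygNorm β (wcomp u φ f) + zygNorm β (K f) := ((hmem f hf).sub (hK.2.1 f hf)).2
    _ ≤ C * blochNorm α f + |C'| * blochNorm α f := by
        gcongr
        · exact hbd f hf
        · exact (hC' f hf).trans (by gcongr; exact le_abs_self _)
    _ ≤ C * 1 + |C'| * 1 := by gcongr
    _ = _ := by ring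

lemma phiLimsup_le_of_compact {α β : ℝ} (hα0 : 0 < α) (hα1 : α < 1) {u φ : ℂ → ℂ}
    (hu : DifferentiableOn ℂ u unitDisk) (hφ : DifferentiableOn ℂ φ unitDisk)
    (hm : MapsTo φ unitDisk unitDisk) (hb : BoundedBlochToZygmund α β u φ)
    {K : (ℂ → ℂ) → ℂ → ℂ} (hK : IsCompactOpToZygmund α β (MemBloch α) K) {ρ : ℝ} (hρ0 : 0 ≤ ρ)
    (hρ : ∀ f, MemBloch α f → blochNorm α f ≤ 1 →
      zygNorm β (fun z => wcomp u φ f z - K f z) ≤ ρ) :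
    phiLimsup φ (firstQuot α β u φ) ≤ 272 * ρ ∧ phiLimsup φ (secondQuot α β u φ) ≤ 272 * ρ := by
  have hF1 : ∀ z ∈ unitDisk, 0 ≤ firstQuot α β u φ z := fun z hz => firstQuot_nonneg hz (hm hz)
  have hF2 : ∀ z ∈ unitDisk, 0 ≤ secondQuot α β u φ z := fun z hz => secondQuot_nonneg hz (hm hz)
  have hmax : ∀ s < (1 : ℝ), 0 ≤ max s (1 / 2) ∧ max s (1 / 2) < 1 := fun s hs =>
    ⟨le_max_of_le_right (by norm_num), max_lt hs (by norm_num)⟩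
  refine ⟨le_of_forall_lt_imp_le_of_dense fun v hv => ?_,
    le_of_forall_lt_imp_le_of_dense fun v hv => ?_⟩
  · rcases lt_or_ge v 0 with hv0 | hv0
    · exact hv0.le.trans (by positivity)
    have := le_of_testValue_large hα0 hα1 hu hφ hm hb hK hρ (x := 1) (y := -1) (v := v / 2)
      (by simp) (by simp) fun s hs => by
        obtain ⟨z, hz, hsz, hvz⟩ := exists_ge_of_lt_phiLimsup hF1 hv0 hv (hmax s hs).1 (hmax s hs).2
        obtain ⟨h1, h2⟩ := max_lt_iff.1 hsz
        refine ⟨z, hz, h1, ?_⟩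
        rw [testValue_one_neg_one (hm hz)]
        nlinarith
    linarith
  · rcases lt_or_ge v 0 with hv0 | hv0
    · exact hv0.le.trans (by positivity)
    have := le_of_testValue_large hα0 hα1 hu hφ hm hb hK hρ (x := 0) (y := 1) (v := v / 2)
      (by simp) (by simp) fun s hs => by
        obtain ⟨z, hz, hsz, hvz⟩ := exists_ge_of_lt_phiLimsup hF2 hv0 hv (hmax s hs).1 (hmax s hs).2
        obtain ⟨h1, h2⟩ := max_lt_iff.1 hsz
        refine ⟨z, hz, h1, ?_⟩
        rw [testValue_zero_one (hm hz)]
        have h3 : (1 / 4 : ℝ) ≤ ‖φ z‖ ^ 2 := by nlinarith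
        nlinarith
    linarith

/-- **Theorem 4.3** (pointwise form). For `0 < α < 1` and `uC_φ : B^α → Z_β` bounded,
`‖uC_φ‖_e` is comparable with the maximum of the two `limsup_{|φ(z)|→1}` quantities, with
constants depending only on `α, β`. -/
theorem essNorm_Bloch_to_Zygmund_of_lt_one'
    (α β : ℝ) (hα0 : 0 < α) (hα1 : α < 1) (hβ : 0 < β) :
    ∃ c C : ℝ, 0 < c ∧ 0 < C ∧
      ∀ u φ : ℂ → ℂ, DifferentiableOn ℂ u unitDisk → DifferentiableOn ℂ φ unitDisk →
        Set.MapsTo φ unitDisk unitDisk → BoundedBlochToZygmund α β u φ →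
        c * max
              (phiLimsup φ (fun z => (1 - ‖z‖ ^ 2) ^ β * ‖2 * deriv u z * deriv φ z + u z * deriv (deriv φ) z‖ / (1 - ‖φ z‖ ^ 2) ^ α))
              (phiLimsup φ (fun z => (1 - ‖z‖ ^ 2) ^ β * (‖u z‖ * ‖deriv φ z‖ ^ 2) / (1 - ‖φ z‖ ^ 2) ^ (α + 1)))
            ≤ essNormZ α β (MemBloch α) u φ ∧
          essNormZ α β (MemBloch α) u φ
            ≤ C * max
                (phiLimsup φ (fun z => (1 - ‖z‖ ^ 2) ^ β * ‖2 * deriv u z * deriv φ z + u z * deriv (deriv φ) z‖ / (1 - ‖φ z‖ ^ 2) ^ α))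
                (phiLimsup φ (fun z => (1 - ‖z‖ ^ 2) ^ β * (‖u z‖ * ‖deriv φ z‖ ^ 2) / (1 - ‖φ z‖ ^ 2) ^ (α + 1))) := by
  refine ⟨1 / 272, 2 + 2 * 4 ^ (α + 1), by norm_num, by positivity, ?_⟩
  intro u φ hu hφ hm hb
  have e1 : (fun z => (1 - ‖z‖ ^ 2) ^ β * ‖2 * deriv u z * deriv φ z + u z * deriv (deriv φ) z‖ /
      (1 - ‖φ z‖ ^ 2) ^ α) = firstQuot α β u φ := rfl
  have e2 : (fun z => (1 - ‖z‖ ^ 2) ^ β * (‖u z‖ * ‖deriv φ z‖ ^ 2) /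
      (1 - ‖φ z‖ ^ 2) ^ (α + 1)) = secondQuot α β u φ := by
    funext z
    rw [secondQuot, secondCoeff, norm_mul, norm_pow]
  rw [e1, e2]
  obtain ⟨D, -, hbound⟩ := exists_coeff_bound hα0 hα1 hu hφ hm hb
  have hF1 : 0 ≤ phiLimsup φ (firstQuot α β u φ) :=
    phiLimsup_nonneg fun z hz => firstQuot_nonneg hz (hm hz)
  have hF2 : 0 ≤ phiLimsup φ (secondQuot α β u φ) :=
    phiLimsup_nonneg fun z hz => secondQuot_nonneg hz (hm hz)
  have h4 : (0 : ℝ) < 4 ^ (α + 1) := by positivity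
  set M₁ := phiLimsup φ (firstQuot α β u φ) with hM₁
  set M₂ := phiLimsup φ (secondQuot α β u φ) with hM₂
  have happrox : ∀ δ > 0, ∃ K, IsCompactOpToZygmund α β (MemBloch α) K ∧
      ∀ f, MemBloch α f → blochNorm α f ≤ 1 →
        zygNorm β (fun z => wcomp u φ f z - K f z) ≤
          2 * (M₁ + δ) + 2 * 4 ^ (α + 1) * (M₂ + δ) + δ := by
    intro δ hδ
    obtain ⟨s₁, hs₁, hs₁', h1⟩ := exists_forall_le_phiLimsup_add (φ := φ)
      (fun z hz => (hbound z hz).2.2.2.1) hδ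
    obtain ⟨s₂, -, hs₂', h2⟩ := exists_forall_le_phiLimsup_add (φ := φ)
      (fun z hz => (hbound z hz).2.2.2.2) hδ
    exact exists_compact_approx hα0 hα1 hu hφ hm hb (s := max s₁ s₂) (le_max_of_le_left hs₁)
      (max_lt hs₁' hs₂') (by positivity) (by positivity)
      (fun z hz hsz => h1 z hz ((le_max_left _ _).trans_lt hsz))
      (fun z hz hsz => h2 z hz ((le_max_right _ _).trans_lt hsz)) hδ
  constructor
  · obtain ⟨K₀, hK₀, -⟩ := happrox 1 one_pos
    refine le_csInf ⟨_, K₀, hK₀, rfl⟩ ?_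
    rintro _ ⟨K, hK, rfl⟩
    have hρ0 : 0 ≤ sSup {s | ∃ f, MemBloch α f ∧ blochNorm α f ≤ 1 ∧
        s = zygNorm β (fun z => wcomp u φ f z - K f z)} := by
      apply Real.sSup_nonneg
      rintro _ ⟨f, -, -, rfl⟩
      exact zygNorm_nonneg _ _
    obtain ⟨h1, h2⟩ := phiLimsup_le_of_compact hα0 hα1 hu hφ hm hb hK hρ0 fun f hf hf1 =>
      le_csSup (bddAbove_opNorm_set hb hK) ⟨f, hf, hf1, rfl⟩
    have := max_le h1 h2
    linarith
  · refine le_of_forall_pos_le_add fun ε hε => ?_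
    set δ := ε / (3 + 2 * 4 ^ (α + 1)) with hδ
    have hδ0 : 0 < δ := by positivity
    obtain ⟨K, hK, hle⟩ := happrox δ hδ0
    have h1 : essNormZ α β (MemBloch α) u φ ≤ sSup {s | ∃ f, MemBloch α f ∧ blochNorm α f ≤ 1 ∧
        s = zygNorm β (fun z => wcomp u φ f z - K f z)} := by
      refine csInf_le ⟨0, ?_⟩ ⟨K, hK, rfl⟩
      rintro _ ⟨L, -, rfl⟩
      apply Real.sSup_nonneg
      rintro _ ⟨f, -, -, rfl⟩
      exact zygNorm_nonneg _ _
    refine h1.trans (Real.sSup_le ?_ (by positivity))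
    rintro _ ⟨f, hf, hf1, rfl⟩
    have hδε : δ * (3 + 2 * 4 ^ (α + 1)) = ε := by
      rw [hδ]
      field_simp
    have h5 := mul_le_mul_of_nonneg_left (le_max_left M₁ M₂) (zero_le_two (α := ℝ))
    have h6 := mul_le_mul_of_nonneg_left (le_max_right M₁ M₂)
      (by positivity : (0 : ℝ) ≤ 2 * 4 ^ (α + 1))
    calc _ ≤ 2 * (M₁ + δ) + 2 * 4 ^ (α + 1) * (M₂ + δ) + δ := hle f hf hf1
      _ = 2 * M₁ + 2 * 4 ^ (α + 1) * M₂ + δ * (3 + 2 * 4 ^ (α + 1)) := by ring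
      _ ≤ _ := by rw [hδε]; linarith

end
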